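/- arXiv:2509.11776 — 2 statements merged into one kernel-verified Lean document; each statement's English description precedes it below -/
import Mathlib

section
/- Let B be a standard one-dimensional Brownian motion started at 0, and let A_t := ∫_0^t 1{B_s > 0} ds be its positive sojourn time. Then for every t > 0, the proportion A_t / t has the arcsine distribution; that is, for all x ∈ [0,1], P(A_t / t ≤ x) = (2/π) · arcsin(√x). Equivalently, A_t/t has density x ↦ 1/(π√(x(1−x))) on (0,1). -/
open MeasureTheory ProbabilityTheory Real Set Filter

noncomputable section

variable {Ω : Type*} [MeasurableSpace Ω]

/-- The positive sojourn time of a process `X` up to time `t`: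
`A_t := ∫_0^t 1{X_s > 0} ds`. -/
def sojourn (X : ℝ → Ω → ℝ) (t : ℝ) (ω : Ω) : ℝ :=
  ∫ s in (0:ℝ)..t, (if 0 < X s ω then (1:ℝ) else 0)

/-- A standard one-dimensional Brownian motion started at `0`: continuous paths a.s.,
`B 0 = 0` a.s., Gaussian increments `B t - B s ~ N(0, t-s)`, and increments
independent of the past. -/
structure IsBrownianMotion (P : Measure Ω) (B : ℝ → Ω → ℝ) : Prop where
  measurable : ∀ t, Measurable (B t)
  start : ∀ᵐ ω ∂P, B 0 ω = 0
  cont : ∀ᵐ ω ∂P, Continuous fun t => B t ω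
  gauss : ∀ s t : ℝ, 0 ≤ s → s ≤ t →
      P.map (fun ω => B t ω - B s ω) = gaussianReal 0 (Real.toNNReal (t - s))
  indep : ∀ s t : ℝ, 0 ≤ s → s ≤ t → ∀ (n : ℕ) (u : Fin n → ℝ),
      (∀ i, 0 ≤ u i ∧ u i ≤ s) →
      IndepFun (fun ω => B t ω - B s ω) (fun ω (i : Fin n) => B (u i) ω) P

/-- The partial sums of a real sequence. -/
def partialSum (x : ℕ → ℝ) (n : ℕ) : ℝ := ∑ i ∈ Finset.range n, x i

/-- The number of strictly positive partial sums among the first `n`. -/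
def positiveCount (n : ℕ) (x : ℕ → ℝ) : ℕ := by
  classical exact ((Finset.range n).filter fun j => 0 < partialSum x (j + 1)).card

/-- The partial sums of index `0, …, n` attain their maximum for the first time at index `k`. -/
def IsFirstMax (n k : ℕ) (x : ℕ → ℝ) : Prop :=
  k ≤ n ∧ (∀ j < k, partialSum x j < partialSum x k) ∧
    ∀ j, k < j → j ≤ n → partialSum x j ≤ partialSum x k

/-- The index map that cyclically moves the entry of index `n` to the front. -/
def rotateIndex (n i : ℕ) : ℕ := if i = 0 then n else if i ≤ n then i - 1 else i

/-- The index map that reverses the first `k` entries. -/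
def reverseIndex (k i : ℕ) : ℕ := if i < k then k - 1 - i else i

/-- Move the entry of index `n` to the front if the partial sum of length `n + 1` is positive. -/
def rotateIfPos (n : ℕ) (x : ℕ → ℝ) : ℕ → ℝ := by
  classical exact if 0 < partialSum x (n + 1) then fun i => x (rotateIndex n i) else x

/-- The Sparre Andersen rearrangement of the first `n` entries of a sequence. -/
def rearrange : ℕ → (ℕ → ℝ) → ℕ → ℝ
  | 0, x => x
  | n + 1, x => rotateIfPos n (rearrange n x)

@[simp] lemma partialSum_zero (x : ℕ → ℝ) : partialSum x 0 = 0 := by simp [partialSum]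

lemma partialSum_succ (x : ℕ → ℝ) (n : ℕ) : partialSum x (n + 1) = partialSum x n + x n :=
  Finset.sum_range_succ _ _

lemma partialSum_neg (x : ℕ → ℝ) (n : ℕ) :
    partialSum (fun i => -x i) n = -partialSum x n := by simp [partialSum]

lemma partialSum_shift (x : ℕ → ℝ) (k j : ℕ) :
    partialSum (fun i => x (k + i)) j = partialSum x (k + j) - partialSum x k := by
  simp [partialSum, Finset.sum_range_add]

lemma measurable_partialSum (n : ℕ) : Measurable fun x => partialSum x n := by
  unfold partialSum; fun_prop

lemma rotateIndex_injective (n : ℕ) : Function.Injective (rotateIndex n) := by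
  intro i j h
  unfold rotateIndex at h
  split_ifs at h <;> omega

lemma reverseIndex_injective (k : ℕ) : Function.Injective (reverseIndex k) := by
  intro i j h
  unfold reverseIndex at h
  split_ifs at h <;> omega

lemma partialSum_rotateIndex (x : ℕ → ℝ) {n j : ℕ} (hj : j ≤ n) :
    partialSum (fun i => x (rotateIndex n i)) (j + 1) = x n + partialSum x j := by
  induction j with
  | zero => simp [partialSum, rotateIndex]
  | succ j ih =>
    rw [partialSum_succ, ih (by omega), partialSum_succ x j]
    have : rotateIndex n (j + 1) = j := by simp [rotateIndex, hj]
    rw [this]; ring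

lemma partialSum_rotateIndex_of_lt (x : ℕ → ℝ) {n j : ℕ} (hj : n < j) :
    partialSum (fun i => x (rotateIndex n i)) j = partialSum x j := by
  induction j, hj using Nat.le_induction with
  | base => rw [partialSum_rotateIndex x le_rfl, partialSum_succ]; ring
  | succ j hj ih =>
    have : rotateIndex n j = j := by unfold rotateIndex; split_ifs <;> omega
    rw [partialSum_succ, ih, partialSum_succ, this]

lemma partialSum_reverseIndex (x : ℕ → ℝ) {k j : ℕ} (hj : j ≤ k) :
    partialSum (fun i => x (reverseIndex k i)) j = partialSum x k - partialSum x (k - j) := by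
  induction j with
  | zero => simp
  | succ j ih =>
    have h : reverseIndex k j = k - (j + 1) := by unfold reverseIndex; split_ifs <;> omega
    have h' : k - j = k - (j + 1) + 1 := by omega
    rw [partialSum_succ, ih (by omega), h, h', partialSum_succ]; ring

lemma partialSum_rotateIfPos_of_lt (x : ℕ → ℝ) {n j : ℕ} (hj : n < j) :
    partialSum (rotateIfPos n x) j = partialSum x j := by
  unfold rotateIfPos
  split_ifs
  · exact partialSum_rotateIndex_of_lt x hj
  · rfl

lemma partialSum_rearrange (x : ℕ → ℝ) {n j : ℕ} (hj : n ≤ j) :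
    partialSum (rearrange n x) j = partialSum x j := by
  induction n with
  | zero => rfl
  | succ n ih => rw [rearrange, partialSum_rotateIfPos_of_lt _ hj, ih (by omega)]

lemma positiveCount_succ (n : ℕ) (x : ℕ → ℝ) [Decidable (0 < partialSum x (n + 1))] :
    positiveCount (n + 1) x =
      if 0 < partialSum x (n + 1) then positiveCount n x + 1 else positiveCount n x := by
  unfold positiveCount
  rw [Finset.range_add_one, Finset.filter_insert]
  split_ifs <;> simp

lemma positiveCount_le (n : ℕ) (x : ℕ → ℝ) : positiveCount n x ≤ n := by
  unfold positiveCount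
  exact (Finset.card_filter_le _ _).trans (by simp)

lemma IsFirstMax.le_of_le {n k : ℕ} {x : ℕ → ℝ} (h : IsFirstMax n k x) {j : ℕ} (hj : j ≤ n) :
    partialSum x j ≤ partialSum x k := by
  rcases lt_trichotomy j k with h' | h' | h'
  · exact (h.2.1 j h').le
  · rw [h']
  · exact h.2.2 j h' hj

lemma IsFirstMax.unique {n k l : ℕ} {x : ℕ → ℝ} (hk : IsFirstMax n k x) (hl : IsFirstMax n l x) :
    k = l := by
  rcases lt_trichotomy k l with h | h | h
  · exact absurd (hl.2.1 k h) (not_lt.2 (hk.le_of_le hl.1))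
  · exact h
  · exact absurd (hk.2.1 l h) (not_lt.2 (hl.le_of_le hk.1))

/-- The rearrangement turns the number of positive partial sums into the position of the first
maximum. -/
lemma isFirstMax_rearrange (n : ℕ) (x : ℕ → ℝ) :
    IsFirstMax n (positiveCount n x) (rearrange n x) := by
  classical
  induction n with
  | zero => refine ⟨by simp [positiveCount], by simp [positiveCount], fun j h h' => by omega⟩
  | succ n ih =>
    have hsum := partialSum_rearrange x (Nat.le_succ n)
    rw [positiveCount_succ, rearrange, rotateIfPos, hsum, ← hsum]
    set y := rearrange n x
    set k := positiveCount n x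
    split_ifs with hpos
    · refine ⟨by have := ih.1; omega, fun j hj => ?_, fun j hj hjn => ?_⟩
      · rw [partialSum_rotateIndex y ih.1]
        cases j with
        | zero =>
          have := ih.le_of_le le_rfl
          rw [partialSum_succ] at hpos
          rw [partialSum_zero]; linarith
        | succ j =>
          rw [partialSum_rotateIndex y (by have := ih.1; omega)]
          linarith [ih.2.1 j (by omega)]
      · obtain ⟨j, rfl⟩ : ∃ i, j = i + 1 := ⟨j - 1, by omega⟩
        rw [partialSum_rotateIndex y ih.1, partialSum_rotateIndex y (by omega)]
        linarith [ih.2.2 j (by omega) (by omega)]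
    · refine ⟨by have := ih.1; omega, ih.2.1, fun j hj hjn => ?_⟩
      rcases Nat.lt_or_ge n j with h | h
      · obtain rfl : j = n + 1 := by omega
        have := ih.le_of_le (Nat.zero_le n)
        rw [partialSum_zero] at this
        linarith
      · exact ih.2.2 j hj h

section Measure

variable (μ : Measure ℝ) [IsProbabilityMeasure μ]

lemma measurePreserving_reindex {σ : ℕ → ℕ} (hσ : Function.Injective σ) :
    MeasurePreserving (fun (x : ℕ → ℝ) i => x (σ i)) (Measure.infinitePi fun _ => μ)
      (Measure.infinitePi fun _ => μ) :=
  ⟨by fun_prop, Measure.map_infinitePi_infinitePi_of_inj hσ⟩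

lemma measurePreserving_neg_infinitePi (hμ : μ.map (fun a => -a) = μ) :
    MeasurePreserving (fun (x : ℕ → ℝ) i => -x i) (Measure.infinitePi fun _ => μ)
      (Measure.infinitePi fun _ => μ) :=
  ⟨by fun_prop, by
    rw [Measure.infinitePi_map_pi (X := fun _ => ℝ) (fun _ => μ) (f := fun _ a => -a)
      (fun _ => measurable_neg)]
    simp only [hμ]⟩

lemma measurePreserving_rotateIfPos (n : ℕ) :
    MeasurePreserving (rotateIfPos n) (Measure.infinitePi fun _ => μ)
      (Measure.infinitePi fun _ => μ) := by
  classical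
  have hrot := measurePreserving_reindex μ (rotateIndex_injective n)
  have hE : MeasurableSet {x : ℕ → ℝ | 0 < partialSum x (n + 1)} :=
    measurableSet_lt measurable_const (measurable_partialSum _)
  have hmeas : Measurable (rotateIfPos n) := Measurable.ite hE hrot.measurable measurable_id
  refine ⟨hmeas, Measure.ext fun s hs => ?_⟩
  have hpre : rotateIfPos n ⁻¹' s ∩ {x | 0 < partialSum x (n + 1)} =
      (fun (x : ℕ → ℝ) i => x (rotateIndex n i)) ⁻¹' (s ∩ {x | 0 < partialSum x (n + 1)}) := by
    ext x
    simp only [mem_inter_iff, mem_preimage, mem_ofPred_eq,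
      partialSum_rotateIndex_of_lt x (Nat.lt_succ_self n)]
    refine and_congr_left fun h => ?_
    rw [rotateIfPos, if_pos h]
  have hpre' : rotateIfPos n ⁻¹' s \ {x | 0 < partialSum x (n + 1)} =
      s \ {x | 0 < partialSum x (n + 1)} := by
    ext x
    simp only [Set.mem_sdiff, mem_preimage, mem_ofPred_eq]
    refine and_congr_left fun h => ?_
    rw [rotateIfPos, if_neg h]
  rw [Measure.map_apply hmeas hs, ← measure_inter_add_sdiff _ hE, hpre, hpre',
    hrot.measure_preimage (hs.inter hE).nullMeasurableSet, measure_inter_add_sdiff _ hE]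

lemma measurePreserving_rearrange (n : ℕ) :
    MeasurePreserving (rearrange n) (Measure.infinitePi fun _ => μ)
      (Measure.infinitePi fun _ => μ) := by
  induction n with
  | zero => exact MeasurePreserving.id _
  | succ n ih => exact (measurePreserving_rotateIfPos μ n).comp ih

/-- The set of sequences whose first `n` nontrivial partial sums are all positive. -/
def positivePath (n : ℕ) : Set (ℕ → ℝ) := {x | ∀ j < n, 0 < partialSum x (j + 1)}

/-- The set of sequences whose first `n` nontrivial partial sums are all nonpositive. -/
def nonposPath (n : ℕ) : Set (ℕ → ℝ) := {x | ∀ j < n, partialSum x (j + 1) ≤ 0}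

lemma measurableSet_positivePath (n : ℕ) : MeasurableSet (positivePath n) := by
  simp only [positivePath, ofPred_forall]
  exact .iInter fun j => .iInter fun _ => measurableSet_lt measurable_const (measurable_partialSum _)

lemma measurableSet_nonposPath (n : ℕ) : MeasurableSet (nonposPath n) := by
  simp only [nonposPath, ofPred_forall]
  exact .iInter fun j => .iInter fun _ => measurableSet_le (measurable_partialSum _) measurable_const

lemma measurableSet_isFirstMax (n k : ℕ) : MeasurableSet {x | IsFirstMax n k x} := by
  refine .inter (.const _) (.inter (?_ : MeasurableSet {x | ∀ j < k, _ < _})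
    (?_ : MeasurableSet {x | ∀ j, k < j → j ≤ n → _ ≤ _}))
  · simp only [ofPred_forall]
    exact .iInter fun j => .iInter fun _ =>
      measurableSet_lt (measurable_partialSum _) (measurable_partialSum _)
  · simp only [ofPred_forall]
    exact .iInter fun j => .iInter fun _ => .iInter fun _ =>
      measurableSet_le (measurable_partialSum _) (measurable_partialSum _)

lemma setOf_positiveCount_eq (n k : ℕ) :
    {x | positiveCount n x = k} = rearrange n ⁻¹' {x | IsFirstMax n k x} := by
  ext x
  exact ⟨fun h => h ▸ isFirstMax_rearrange n x, fun h => (isFirstMax_rearrange n x).unique h⟩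

lemma measurable_positiveCount (n : ℕ) : Measurable (positiveCount n) := by
  refine measurable_to_countable' fun k => ?_
  change MeasurableSet {x | positiveCount n x = k}
  rw [setOf_positiveCount_eq]
  exact (measurePreserving_rearrange (Measure.dirac 0) n).measurable (measurableSet_isFirstMax n k)

lemma measure_positiveCount_eq (n k : ℕ) :
    Measure.infinitePi (fun _ => μ) {x | positiveCount n x = k} =
      Measure.infinitePi (fun _ => μ) {x | IsFirstMax n k x} := by
  rw [setOf_positiveCount_eq, (measurePreserving_rearrange μ n).measure_preimage
    (measurableSet_isFirstMax n k).nullMeasurableSet]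

lemma indepFun_truncate_shift (k : ℕ) :
    IndepFun (fun (x : ℕ → ℝ) i => if i < k then x i else 0) (fun (x : ℕ → ℝ) i => x (k + i))
      (Measure.infinitePi fun _ => μ) := by
  have h : iIndepFun (fun i (x : ℕ → ℝ) => x i) (Measure.infinitePi fun _ => μ) :=
    iIndepFun_infinitePi (X := fun _ a => a) (fun _ => measurable_id)
  refine IndepFun.process_indepFun_process (X := fun i (x : ℕ → ℝ) => if i < k then x i else 0)
    (Y := fun i (x : ℕ → ℝ) => x (k + i)) (fun i => ?_) (fun i => by fun_prop) fun I J => ?_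
  · split_ifs <;> fun_prop
  have hind := h.indepFun_finset (Finset.range k) (J.map (addLeftEmbedding k))
    (by simp [Finset.disjoint_left]; omega) (fun i => by fun_prop)
  refine hind.comp
    (φ := fun y (i : I) => if h : (i : ℕ) < k then y ⟨i, Finset.mem_range.2 h⟩ else 0)
    (ψ := fun y (j : J) => y ⟨k + j, Finset.mem_map_of_mem (addLeftEmbedding k) j.2⟩)
    ?_ (measurable_pi_lambda _ fun j => measurable_pi_apply _) |>.congr ?_ ?_
  · refine measurable_pi_lambda _ fun i => ?_
    split_ifs <;> fun_prop
  · exact .of_forall fun x => by ext i; simp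
  · exact .of_forall fun x => by ext i; simp

lemma measure_isFirstMax {n k : ℕ} (hk : k ≤ n) :
    Measure.infinitePi (fun _ => μ) {x | IsFirstMax n k x} =
      Measure.infinitePi (fun _ => μ) (positivePath k) *
        Measure.infinitePi (fun _ => μ) (nonposPath (n - k)) := by
  set rev := fun (x : ℕ → ℝ) i => x (reverseIndex k i)
  have hrev : MeasurePreserving rev _ _ := measurePreserving_reindex μ (reverseIndex_injective k)
  have hshift := measurePreserving_reindex μ (σ := fun i => k + i) (add_right_injective k)
  set trunc := fun (x : ℕ → ℝ) i => if i < k then x i else 0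
  have htrunc : ∀ x, ∀ j ≤ k, partialSum (trunc x) j = partialSum x j := by
    intro x j hj
    refine Finset.sum_congr rfl fun i hi => ?_
    rw [Finset.mem_range] at hi
    simp [trunc, hi.trans_le hj]
  have hpos : ∀ x, rev x ∈ positivePath k ↔ ∀ j < k, partialSum x j < partialSum x k := by
    intro x
    refine ⟨fun h j hj => ?_, fun h j hj => ?_⟩
    · have := h (k - 1 - j) (by omega)
      rw [partialSum_reverseIndex x (by omega), show k - (k - 1 - j + 1) = j by omega] at this
      linarith
    · rw [partialSum_reverseIndex x (by omega)]
      linarith [h (k - (j + 1)) (by omega)]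
  have htr : ∀ x, rev (trunc x) ∈ positivePath k ↔ rev x ∈ positivePath k := by
    intro x
    rw [hpos, hpos, htrunc x k le_rfl]
    exact forall₂_congr fun j hj => by rw [htrunc x j hj.le]
  have hset : {x | IsFirstMax n k x} =
      trunc ⁻¹' (rev ⁻¹' positivePath k) ∩ (fun x i => x (k + i)) ⁻¹' nonposPath (n - k) := by
    ext x
    simp only [IsFirstMax, mem_ofPred_eq, hk, true_and, mem_inter_iff, mem_preimage, htr, hpos]
    refine and_congr_right fun _ => ⟨fun h j hj => ?_, fun h j hj hjn => ?_⟩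
    · rw [partialSum_shift]; linarith [h (k + (j + 1)) (by omega) (by omega)]
    · have := h (j - k - 1) (by omega)
      rw [partialSum_shift, show k + (j - k - 1 + 1) = j by omega] at this
      linarith
  rw [hset, (indepFun_truncate_shift μ k).measure_inter_preimage_eq_mul _ _
    (hrev.measurable (measurableSet_positivePath k)) (measurableSet_nonposPath _),
    hshift.measure_preimage (measurableSet_nonposPath _).nullMeasurableSet,
    ← hrev.measure_preimage (measurableSet_positivePath k).nullMeasurableSet]
  congr 2
  ext x
  exact htr x

lemma measure_partialSum_eq_zero [NullSingletonClass μ] (n : ℕ) :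
    Measure.infinitePi (fun _ => μ) {x | partialSum x (n + 1) = 0} = 0 := by
  have h : iIndepFun (fun i (x : ℕ → ℝ) => x i) (Measure.infinitePi fun _ => μ) :=
    iIndepFun_infinitePi (X := fun _ a => a) (fun _ => measurable_id)
  have hind : IndepFun (fun x => partialSum x n) (fun x => x n) (Measure.infinitePi fun _ => μ) := by
    have := h.indepFun_finsetSum_of_notMem (fun i => measurable_pi_apply i)
      (Finset.notMem_range_self (n := n))
    refine this.congr (.of_forall fun x => ?_) .rfl
    simp [partialSum]
  have hprod := (indepFun_iff_map_prod_eq_prod_map_map (measurable_partialSum n).aemeasurable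
    (measurable_pi_apply n).aemeasurable).1 hind
  rw [Measure.infinitePi_map_eval (X := fun _ => ℝ) (fun _ => μ)] at hprod
  have hS : MeasurableSet {p : ℝ × ℝ | p.1 + p.2 = 0} :=
    measurableSet_eq_fun (by fun_prop) (by fun_prop)
  have hset : {x : ℕ → ℝ | partialSum x (n + 1) = 0} =
      (fun x => (partialSum x n, x n)) ⁻¹' {p : ℝ × ℝ | p.1 + p.2 = 0} := by
    ext x; simp [partialSum_succ]
  rw [hset, ← Measure.map_apply ((measurable_partialSum n).prodMk (by fun_prop)) hS, hprod,
    Measure.measure_prod_null hS]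
  refine .of_forall fun a => ?_
  have : Prod.mk a ⁻¹' {p : ℝ × ℝ | p.1 + p.2 = 0} = {-a} := by
    ext b; simp [add_comm a b, eq_neg_iff_add_eq_zero]
  change μ (Prod.mk a ⁻¹' _) = 0
  rw [this, measure_singleton]

lemma measure_nonposPath [NullSingletonClass μ] (hμ : μ.map (fun a => -a) = μ) (n : ℕ) :
    Measure.infinitePi (fun _ => μ) (nonposPath n) =
      Measure.infinitePi (fun _ => μ) (positivePath n) := by
  rw [← (measurePreserving_neg_infinitePi μ hμ).measure_preimage
    (measurableSet_positivePath n).nullMeasurableSet]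
  refine measure_congr ?_
  have hne : ∀ᵐ x ∂Measure.infinitePi (fun _ => μ), ∀ j, partialSum x (j + 1) ≠ 0 :=
    ae_all_iff.2 fun j => by simpa [ae_iff] using measure_partialSum_eq_zero μ j
  filter_upwards [hne] with x hx
  refine propext (forall₂_congr fun j _ => ?_)
  rw [partialSum_neg, neg_pos, (hx j).le_iff_lt]

lemma measureReal_positiveCount_eq [NullSingletonClass μ] (hμ : μ.map (fun a => -a) = μ) {n k : ℕ}
    (hk : k ≤ n) :
    (Measure.infinitePi fun _ => μ).real {x | positiveCount n x = k} =
      (Measure.infinitePi fun _ => μ).real (positivePath k) *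
        (Measure.infinitePi fun _ => μ).real (positivePath (n - k)) := by
  simp only [measureReal_def]
  rw [measure_positiveCount_eq, measure_isFirstMax μ hk, measure_nonposPath μ hμ,
    ENNReal.toReal_mul]

end Measure

/-- The density of the arcsine distribution. -/
def arcsineDensity (x : ℝ) : ℝ :=
  if x ∈ Set.Ioo (0:ℝ) 1 then 1 / (π * Real.sqrt (x * (1 - x))) else 0

/-- The arcsine distribution. -/
def arcsineMeasure : Measure ℝ := volume.withDensity fun x => ENNReal.ofReal (arcsineDensity x)

lemma arcsineDensity_nonneg (x : ℝ) : 0 ≤ arcsineDensity x := by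
  unfold arcsineDensity
  split_ifs <;> positivity

lemma measurable_arcsineDensity : Measurable arcsineDensity :=
  Measurable.ite measurableSet_Ioo (by fun_prop) measurable_const

lemma beta_half_half : beta (1 / 2) (1 / 2) = π := by
  rw [beta, Real.Gamma_one_half_eq, add_halves, Real.Gamma_one, div_one,
    Real.mul_self_sqrt pi_pos.le]

/-- Multiplying the arcsine density by `x ^ k * (1 - x) ^ m` gives a multiple of a beta density. -/
lemma arcsineDensity_mul_pow (k m : ℕ) (x : ℝ) :
    arcsineDensity x * (x ^ k * (1 - x) ^ m) =
      beta (k + 1 / 2) (m + 1 / 2) / π * betaPDFReal (k + 1 / 2) (m + 1 / 2) x := by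
  unfold arcsineDensity betaPDFReal
  simp only [mem_Ioo]
  split_ifs with h
  · have hb : beta (k + 1 / 2) (m + 1 / 2) ≠ 0 := (beta_pos (by positivity) (by positivity)).ne'
    have hx : 0 < x := h.1
    have hy : 0 < 1 - x := by linarith [h.2]
    have key : ∀ (y : ℝ) (_ : 0 < y) (j : ℕ), y ^ ((j : ℝ) + 1 / 2 - 1) = y ^ j / √y := by
      intro y hy j
      rw [show (j : ℝ) + 1 / 2 - 1 = j - 1 / 2 by ring, Real.rpow_sub hy, Real.rpow_natCast,
        Real.sqrt_eq_rpow]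
    rw [key x hx, key _ hy, Real.sqrt_mul hx.le]
    have := (Real.sqrt_pos.2 hx).ne'
    have := (Real.sqrt_pos.2 hy).ne'
    generalize beta (k + 1 / 2) (m + 1 / 2) = b at hb
    field_simp
  · simp

instance isProbabilityMeasure_arcsineMeasure : IsProbabilityMeasure arcsineMeasure := by
  have h : arcsineMeasure = betaMeasure (1 / 2) (1 / 2) := by
    unfold arcsineMeasure betaMeasure betaPDF
    congr! 3 with x
    have := arcsineDensity_mul_pow 0 0 x
    simpa only [Nat.cast_zero, zero_add, pow_zero, mul_one, beta_half_half, div_self pi_ne_zero,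
      one_mul] using this
  rw [h]
  exact isProbabilityMeasureBeta (by norm_num) (by norm_num)

lemma integral_arcsineMeasure (g : ℝ → ℝ) :
    ∫ x, g x ∂arcsineMeasure = ∫ x, arcsineDensity x * g x := by
  rw [arcsineMeasure, integral_withDensity_eq_integral_toReal_smul
    measurable_arcsineDensity.ennreal_ofReal (by simp)]
  simp [ENNReal.toReal_ofReal (arcsineDensity_nonneg _)]

lemma integral_betaPDFReal {α β : ℝ} (hα : 0 < α) (hβ : 0 < β) : ∫ x, betaPDFReal α β x = 1 := by
  rw [integral_eq_lintegral_of_nonneg_ae (.of_forall fun x => ?_)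
    (measurable_betaPDFReal α β).aestronglyMeasurable]
  · exact (ENNReal.toReal_eq_one_iff _).2 (lintegral_betaPDF_eq_one hα hβ)
  · by_cases h : 0 < x ∧ x < 1
    · exact (betaPDFReal_pos h.1 h.2 hα hβ).le
    · simp [betaPDFReal, h]

lemma integral_pow_mul_pow_arcsineMeasure (k m : ℕ) :
    ∫ x, x ^ k * (1 - x) ^ m ∂arcsineMeasure = beta (k + 1 / 2) (m + 1 / 2) / π := by
  simp_rw [integral_arcsineMeasure, arcsineDensity_mul_pow]
  rw [integral_const_mul, integral_betaPDFReal (by positivity) (by positivity), mul_one]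

/-- The normalized central binomial coefficient `(2k choose k) / 4 ^ k`. -/
def halfCoeff (k : ℕ) : ℝ := Real.Gamma (k + 1 / 2) / (k.factorial * √π)

lemma halfCoeff_mul {n k : ℕ} (hk : k ≤ n) :
    halfCoeff k * halfCoeff (n - k) =
      n.choose k * ∫ x, x ^ k * (1 - x) ^ (n - k) ∂arcsineMeasure := by
  obtain ⟨m, rfl⟩ := Nat.exists_eq_add_of_le hk
  rw [integral_pow_mul_pow_arcsineMeasure, Nat.add_sub_cancel_left, halfCoeff, halfCoeff, beta,
    show (k : ℝ) + 1 / 2 + (m + 1 / 2) = (k + m : ℕ) + 1 by push_cast; ring,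
    Real.Gamma_nat_eq_factorial]
  have hc : ((k + m).choose k : ℝ) * k.factorial * m.factorial = (k + m).factorial := by
    rw [Nat.choose_symm_add]
    exact_mod_cast Nat.add_choose_mul_factorial_mul_factorial k m
  have h1 : ((k + m).factorial : ℝ) ≠ 0 := by positivity
  have h2 : √π ≠ 0 := (Real.sqrt_pos.2 pi_pos).ne'
  rw [show Real.Gamma (k + 1 / 2) / (k.factorial * √π) * (Real.Gamma (m + 1 / 2) / (m.factorial * √π))
    = Real.Gamma (k + 1 / 2) * Real.Gamma (m + 1 / 2) / (k.factorial * m.factorial * (√π * √π)) by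
      field_simp, Real.mul_self_sqrt pi_pos.le]
  field_simp
  rw [← hc]; ring

lemma ae_arcsineMeasure_mem_Ioo : ∀ᵐ x ∂arcsineMeasure, x ∈ Ioo (0 : ℝ) 1 := by
  rw [arcsineMeasure, ae_withDensity_iff measurable_arcsineDensity.ennreal_ofReal]
  refine .of_forall fun x hx => ?_
  by_contra h
  simp [arcsineDensity, h] at hx

lemma integrable_pow_mul_pow_arcsineMeasure (k m : ℕ) :
    Integrable (fun x : ℝ => x ^ k * (1 - x) ^ m) arcsineMeasure := by
  refine Integrable.of_bound (C := 1) (by fun_prop) ?_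
  filter_upwards [ae_arcsineMeasure_mem_Ioo] with x hx
  have h1 : 0 ≤ 1 - x := by linarith [hx.2]
  rw [norm_mul, norm_pow, norm_pow, norm_of_nonneg hx.1.le, norm_of_nonneg h1]
  exact mul_le_one₀ (pow_le_one₀ hx.1.le hx.2.le) (by positivity)
    (pow_le_one₀ h1 (by linarith [hx.1]))

lemma integral_sum_bernstein_arcsineMeasure (f : ℝ → ℝ) (n : ℕ) :
    ∫ x, ∑ k ∈ Finset.range (n + 1), n.choose k * (x ^ k * (1 - x) ^ (n - k)) * f k
        ∂arcsineMeasure =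
      ∑ k ∈ Finset.range (n + 1), halfCoeff k * halfCoeff (n - k) * f k := by
  rw [integral_finsetSum _ fun k _ =>
    ((integrable_pow_mul_pow_arcsineMeasure _ _).const_mul _).mul_const _]
  refine Finset.sum_congr rfl fun k hk => ?_
  rw [integral_mul_const, integral_const_mul,
    halfCoeff_mul (Nat.lt_succ_iff.1 (Finset.mem_range.1 hk))]

lemma sum_halfCoeff_mul (n : ℕ) :
    ∑ k ∈ Finset.range (n + 1), halfCoeff k * halfCoeff (n - k) = 1 := by
  have h := integral_sum_bernstein_arcsineMeasure (fun _ => 1) n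
  simp only [mul_one] at h
  rw [← h]
  have hone : ∀ x : ℝ,
      ∑ k ∈ Finset.range (n + 1), n.choose k * (x ^ k * (1 - x) ^ (n - k)) = 1 := by
    intro x
    have h := add_pow x (1 - x) n
    rw [add_sub_cancel, one_pow] at h
    refine Eq.trans ?_ h.symm
    exact Finset.sum_congr rfl fun k _ => by ring
  simp [hone]

lemma halfCoeff_zero : halfCoeff 0 = 1 := by
  have h2 : √π ≠ 0 := (Real.sqrt_pos.2 pi_pos).ne'
  rw [halfCoeff, Nat.cast_zero, zero_add, Real.Gamma_one_half_eq, Nat.factorial_zero, Nat.cast_one,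
    one_mul, div_self h2]

/-- A sequence whose self-convolution is constantly `1` is the sequence of normalized central
binomial coefficients. -/
lemma eq_halfCoeff {u : ℕ → ℝ} (h0 : u 0 = 1)
    (hu : ∀ n, ∑ k ∈ Finset.range (n + 1), u k * u (n - k) = 1) (n : ℕ) : u n = halfCoeff n := by
  induction n using Nat.strong_induction_on with
  | _ n ih =>
    rcases n with _ | n
    · rw [h0, halfCoeff_zero]
    have h1 := hu (n + 1)
    have h2 := sum_halfCoeff_mul (n + 1)
    rw [Finset.sum_range_succ, Finset.sum_range_succ'] at h1 h2
    have h3 : ∑ k ∈ Finset.range n, u (k + 1) * u (n + 1 - (k + 1)) =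
        ∑ k ∈ Finset.range n, halfCoeff (k + 1) * halfCoeff (n + 1 - (k + 1)) := by
      refine Finset.sum_congr rfl fun k hk => ?_
      rw [Finset.mem_range] at hk
      rw [ih (k + 1) (by omega), ih (n + 1 - (k + 1)) (by omega)]
    simp only [Nat.sub_self, Nat.sub_zero, h0, halfCoeff_zero, one_mul, mul_one] at h1 h2
    linarith

open scoped unitInterval in
/-- The means of `f` over the beta-binomial distributions converge to the mean of `f` over the
arcsine distribution. -/
lemma tendsto_sum_halfCoeff (f : C(ℝ, ℝ)) :
    Tendsto (fun n : ℕ => ∑ k ∈ Finset.range (n + 1),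
        halfCoeff k * halfCoeff (n - k) * f ((k : ℝ) / n))
      atTop (nhds (∫ x, f x ∂arcsineMeasure)) := by
  let g : C(I, ℝ) := f.restrict I
  have hunif := bernsteinApproximation_uniform g
  have happ : ∀ (n : ℕ) (x : I), ∑ k ∈ Finset.range (n + 1),
      n.choose k * ((x : ℝ) ^ k * (1 - x) ^ (n - k)) * f ((k : ℝ) / n) =
        bernsteinApproximation n g x := by
    intro n x
    rw [bernsteinApproximation.apply, Finset.sum_range]
    refine Finset.sum_congr rfl fun k _ => ?_
    rw [bernstein_apply, smul_eq_mul, ← mul_assoc (Nat.choose n k : ℝ)]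
    rfl
  obtain ⟨C, hC⟩ := (hunif.norm.bddAbove_range)
  have hC' : ∀ (n : ℕ) (x : I), ‖bernsteinApproximation n g x‖ ≤ C := fun n x =>
    (ContinuousMap.norm_coe_le_norm _ x).trans (hC ⟨n, rfl⟩)
  simp_rw [← fun n : ℕ => integral_sum_bernstein_arcsineMeasure (fun k => f (k / n)) n]
  refine tendsto_integral_of_dominated_convergence (fun _ => C) (fun n => by fun_prop)
    (integrable_const C) (fun n => ?_) ?_
  · filter_upwards [ae_arcsineMeasure_mem_Ioo] with x hx
    rw [happ n ⟨x, hx.1.le, hx.2.le⟩]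
    exact hC' n _
  · filter_upwards [ae_arcsineMeasure_mem_Ioo] with x hx
    simp_rw [happ _ ⟨x, hx.1.le, hx.2.le⟩]
    exact ((continuous_eval_const (F := C(I, ℝ)) (⟨x, hx.1.le, hx.2.le⟩ : I)).tendsto g).comp hunif

section RandomWalk
variable (μ : Measure ℝ) [IsProbabilityMeasure μ]

lemma integral_positiveCount (n : ℕ) (f : ℕ → ℝ) :
    ∫ x, f (positiveCount n x) ∂Measure.infinitePi (fun _ => μ) =
      ∑ k ∈ Finset.range (n + 1),
        (Measure.infinitePi fun _ => μ).real {x | positiveCount n x = k} * f k := by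
  have hE : ∀ k, MeasurableSet {x | positiveCount n x = k} := fun k =>
    measurable_positiveCount n (measurableSet_singleton k)
  have h : ∀ x, f (positiveCount n x) = ∑ k ∈ Finset.range (n + 1),
      {x | positiveCount n x = k}.indicator (fun _ => f k) x := by
    intro x
    rw [Finset.sum_eq_single_of_mem (positiveCount n x)
      (Finset.mem_range.2 (Nat.lt_succ_of_le (positiveCount_le n x)))]
    · simp
    · intro k _ hk
      exact indicator_of_notMem (fun h => hk h.symm) _
  simp_rw [h]
  rw [integral_finsetSum _ fun k _ => (integrable_const _).indicator (hE k)]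
  refine Finset.sum_congr rfl fun k _ => ?_
  rw [integral_indicator_const _ (hE k), smul_eq_mul]

variable [NullSingletonClass μ]

lemma measureReal_positivePath (hμ : μ.map (fun a => -a) = μ) (n : ℕ) :
    (Measure.infinitePi fun _ => μ).real (positivePath n) = halfCoeff n := by
  refine eq_halfCoeff (u := fun n => (Measure.infinitePi fun _ => μ).real (positivePath n))
    (by simp [positivePath]) (fun n => ?_) n
  have h := integral_positiveCount μ n fun _ => 1
  simp only [integral_const, probReal_univ, smul_eq_mul, mul_one] at h
  rw [h]
  refine Finset.sum_congr rfl fun k hk => ?_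
  rw [measureReal_positiveCount_eq μ hμ (Nat.lt_succ_iff.1 (Finset.mem_range.1 hk))]

/-- **Sparre Andersen's theorem**: the number of positive partial sums of a symmetric random walk
with diffuse steps follows a beta-binomial distribution. -/
lemma integral_positiveCount_eq_sum (hμ : μ.map (fun a => -a) = μ) (n : ℕ) (f : ℕ → ℝ) :
    ∫ x, f (positiveCount n x) ∂Measure.infinitePi (fun _ => μ) =
      ∑ k ∈ Finset.range (n + 1), halfCoeff k * halfCoeff (n - k) * f k := by
  rw [integral_positiveCount]
  refine Finset.sum_congr rfl fun k hk => ?_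
  rw [measureReal_positiveCount_eq μ hμ (Nat.lt_succ_iff.1 (Finset.mem_range.1 hk)),
    measureReal_positivePath μ hμ, measureReal_positivePath μ hμ]

end RandomWalk

/-- Random variables indexed by `ℕ` are independent as soon as each one is independent of the
preceding ones. -/
lemma iIndepFun_of_indepFun_past {P : Measure Ω}
    [IsProbabilityMeasure P] {X : ℕ → Ω → ℝ}
    (h : ∀ n, IndepFun (X n) (fun ω (i : Fin n) => X i ω) P) : iIndepFun X P := by
  rw [iIndepFun_iff_measure_inter_preimage_eq_mul]
  intro S
  induction S using Finset.induction_on_max with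
  | empty => simp
  | insert a S hS ih =>
    intro s hs
    rw [Finset.prod_insert (fun ha => (hS a ha).false), Finset.set_biInter_insert,
      ← ih fun i hi => hs i (Finset.mem_insert_of_mem hi)]
    have hset : ⋂ i ∈ S, X i ⁻¹' s i =
        (fun ω (i : Fin a) => X i ω) ⁻¹' ⋂ i ∈ S, {y | ∀ h : i < a, y ⟨i, h⟩ ∈ s i} := by
      ext ω
      simp only [mem_iInter, mem_preimage, mem_ofPred_eq]
      exact forall₂_congr fun i hi => ⟨fun h _ => h, fun h => h (hS i hi)⟩
    rw [hset]
    refine (h a).measure_inter_preimage_eq_mul _ _ (hs a (Finset.mem_insert_self a S)) ?_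
    refine Finset.measurableSet_biInter _ fun i hi => ?_
    simp only [hS i hi, forall_true_left]
    exact measurable_pi_apply _ (hs i (Finset.mem_insert_of_mem hi))

/-- The right Riemann sums of a function that is bounded and almost everywhere continuous on
`[0, 1]` converge to its integral. -/
lemma tendsto_riemannSum_of_ae_continuousAt {f : ℝ → ℝ} {C : ℝ} (hf : Measurable f)
    (hC : ∀ s, |f s| ≤ C) (hcont : ∀ᵐ s ∂volume.restrict (Ioc (0 : ℝ) 1), ContinuousAt f s) :
    Tendsto (fun n : ℕ => (∑ j ∈ Finset.range n, f (((j + 1 : ℕ) : ℝ) / n)) / n) atTop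
      (nhds (∫ s in (0 : ℝ)..1, f s)) := by
  have hstep : ∀ n : ℕ, 0 < n → (∑ j ∈ Finset.range n, f (((j + 1 : ℕ) : ℝ) / n)) / n =
      ∫ s in (0 : ℝ)..1, f (⌈s * n⌉ / n) := by
    intro n hn
    have hn' : (0 : ℝ) < n := Nat.cast_pos.2 hn
    have hpiece : ∀ j : ℕ, EqOn (fun s : ℝ => f (⌈s * n⌉ / n))
        (fun _ => f (((j + 1 : ℕ) : ℝ) / n)) (Ioc ((j : ℝ) / n) (((j + 1 : ℕ) : ℝ) / n)) := by
      intro j s hs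
      have : ⌈s * n⌉ = ((j + 1 : ℕ) : ℤ) := by
        rw [Int.ceil_eq_iff]
        have h1 := (div_lt_iff₀ hn').1 hs.1
        have h2 := (le_div_iff₀ hn').1 hs.2
        push_cast at h2 ⊢
        constructor <;> linarith
      simp [this]
    have hle : ∀ j : ℕ, (j : ℝ) / n ≤ ((j + 1 : ℕ) : ℝ) / n := fun j => by
      gcongr; simp
    have hsum := intervalIntegral.sum_integral_adjacent_intervals
      (f := fun s : ℝ => f (⌈s * n⌉ / n)) (μ := volume) (a := fun j : ℕ => (j : ℝ) / n) (n := n)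
      fun j _ => by
        rw [intervalIntegrable_iff_integrableOn_Ioc_of_le (hle j)]
        exact (integrableOn_congr_fun (hpiece j) measurableSet_Ioc).2 (by simp)
    rw [Nat.cast_zero, zero_div, div_self hn'.ne'] at hsum
    rw [← hsum, Finset.sum_div]
    refine Finset.sum_congr rfl fun j _ => ?_
    rw [intervalIntegral.integral_of_le (hle j),
      setIntegral_congr_fun measurableSet_Ioc (hpiece j), ← intervalIntegral.integral_of_le (hle j),
      intervalIntegral.integral_const, smul_eq_mul]
    push_cast
    field_simp
    ring
  refine Tendsto.congr' (f₁ := fun n : ℕ => ∫ s in (0 : ℝ)..1, f (⌈s * n⌉ / n))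
    (eventually_gt_atTop 0 |>.mono fun n hn => (hstep n hn).symm) ?_
  simp_rw [intervalIntegral.integral_of_le zero_le_one]
  refine tendsto_integral_of_dominated_convergence (fun _ => C) (fun n => ?_)
    (integrable_const C) (fun n => .of_forall fun s => hC _) ?_
  · exact (hf.comp (by fun_prop)).aestronglyMeasurable
  · filter_upwards [hcont, ae_restrict_mem measurableSet_Ioc] with s hs hs0
    refine hs.tendsto.comp ?_
    have := (tendsto_nat_ceil_mul_div_atTop (R := ℝ) hs0.1.le).comp tendsto_natCast_atTop_atTop
    refine this.congr fun n => ?_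
    simp only [Function.comp]
    rw [natCast_ceil_eq_intCast_ceil (mul_nonneg hs0.1.le n.cast_nonneg)]

/-- The mass that the arcsine distribution gives to a left half-line. -/
lemma arcsineMeasure_Iic {x : ℝ} (hx : x ∈ Icc (0 : ℝ) 1) :
    arcsineMeasure (Iic x) = ENNReal.ofReal (2 / π * Real.arcsin (√x)) := by
  have hint : Integrable arcsineDensity := by
    refine ⟨measurable_arcsineDensity.aestronglyMeasurable, ?_⟩
    have h : arcsineMeasure univ < ⊤ := measure_lt_top _ _
    rw [arcsineMeasure, withDensity_apply _ .univ, Measure.restrict_univ] at h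
    rw [hasFiniteIntegral_iff_norm]
    simpa only [norm_of_nonneg (arcsineDensity_nonneg _)] using h
  have hFTC : ∫ s in (0 : ℝ)..x, arcsineDensity s = 2 / π * Real.arcsin (√x) := by
    rw [intervalIntegral.integral_eq_sub_of_hasDerivAt_of_le hx.1
      (f := fun s => 2 / π * Real.arcsin (√s)) (by fun_prop) (fun s hs => ?_)
      hint.intervalIntegrable]
    · simp
    · have hs1 : s < 1 := hs.2.trans_le hx.2
      have hpos : 0 < √s := Real.sqrt_pos.2 hs.1
      have hlt : √s < 1 := by rwa [Real.sqrt_lt' one_pos, one_pow]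
      have hd := ((Real.hasDerivAt_arcsin (by linarith) hlt.ne).comp s
        (Real.hasDerivAt_sqrt hs.1.ne')).const_mul (2 / π)
      refine hd.congr_deriv ?_
      have h1 : √(1 - s) ≠ 0 := (Real.sqrt_pos.2 (by linarith)).ne'
      have hmem : s ∈ Ioo (0 : ℝ) 1 := ⟨hs.1, hs1⟩
      rw [arcsineDensity, if_pos hmem, Real.sq_sqrt hs.1.le, Real.sqrt_mul hs.1.le]
      field_simp
  rw [arcsineMeasure, withDensity_apply _ measurableSet_Iic,
    ← ofReal_integral_eq_lintegral_ofReal hint.integrableOn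
      (.of_forall fun s => arcsineDensity_nonneg s), ← hFTC, intervalIntegral.integral_of_le hx.1]
  congr 1
  refine setIntegral_eq_of_subset_of_forall_sdiff_eq_zero measurableSet_Iic (fun s hs => hs.2)
    fun s hs => ?_
  rw [arcsineDensity, if_neg]
  exact fun h => hs.2 ⟨h.1, hs.1⟩

lemma partialSum_increments (b : ℝ → ℝ) (h : ℝ) (j : ℕ) :
    partialSum (fun i : ℕ => b ((i + 1 : ℕ) * h) - b (i * h)) j = b (j * h) - b 0 := by
  rw [partialSum, Finset.sum_range_sub (fun i : ℕ => b (i * h))]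
  simp

namespace IsBrownianMotion

variable {P : Measure Ω} {B : ℝ → Ω → ℝ}

lemma ae_ne_zero (hB : IsBrownianMotion P B) {s : ℝ} (hs : 0 < s) : ∀ᵐ ω ∂P, B s ω ≠ 0 := by
  have hv : (s - 0).toNNReal ≠ 0 := by simpa using hs
  have := nullSingletonClass_gaussianReal (μ := 0) hv
  have h : ∀ᵐ y ∂P.map (fun ω => B s ω - B 0 ω), y ≠ 0 := by
    rw [hB.gauss 0 s le_rfl hs.le]
    simpa [ae_iff] using measure_singleton (μ := gaussianReal 0 (s - 0).toNNReal) 0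
  filter_upwards [ae_of_ae_map ((hB.measurable s).sub (hB.measurable 0)).aemeasurable h, hB.start]
    with ω h1 h2
  simpa [h2] using h1

variable [IsProbabilityMeasure P]

/-- The increments of Brownian motion along a regular grid are independent and Gaussian. -/
lemma map_increments (hB : IsBrownianMotion P B) {h : ℝ} (hh : 0 ≤ h) :
    P.map (fun ω (i : ℕ) => B ((i + 1 : ℕ) * h) ω - B (i * h) ω) =
      Measure.infinitePi fun _ => gaussianReal 0 h.toNNReal := by
  have hmeas : ∀ i : ℕ, Measurable fun ω => B ((i + 1 : ℕ) * h) ω - B (i * h) ω := fun i =>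
    (hB.measurable _).sub (hB.measurable _)
  have hind : iIndepFun (fun (i : ℕ) ω => B ((i + 1 : ℕ) * h) ω - B (i * h) ω) P := by
    refine iIndepFun_of_indepFun_past fun n => ?_
    have := hB.indep (n * h) ((n + 1 : ℕ) * h) (by positivity) (by gcongr; simp) (n + 1)
      (fun i => (i : ℕ) * h) fun i => ⟨by positivity, by gcongr; exact Nat.lt_succ_iff.1 i.2⟩
    exact this.comp measurable_id
      (ψ := fun y (i : Fin n) => y i.succ - y i.castSucc) (by fun_prop)
  rw [hind.map_fun_eq_infinitePi_map hmeas]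
  congr with i : 1
  rw [hB.gauss _ _ (by positivity) (by gcongr; simp)]
  congr 2
  push_cast; ring

/-- Almost surely, Brownian motion vanishes only on a set of times of measure zero. -/
lemma ae_ae_ne_zero (hB : IsBrownianMotion P B) :
    ∀ᵐ ω ∂P, ∀ᵐ s ∂volume.restrict (Ioi (0 : ℝ)), B s ω ≠ 0 := by
  classical
  obtain ⟨N, hN, hNm, hN0⟩ := exists_measurable_superset_of_null (ae_iff.1 hB.cont)
  have hNae : ∀ᵐ ω ∂P, ω ∉ N := measure_eq_zero_iff_ae_notMem.1 hN0
  let B' : ℝ → Ω → ℝ := fun s ω => if ω ∈ N then 0 else B s ω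
  have hB' : Measurable (Function.uncurry B') := by
    refine measurable_uncurry_of_continuous_of_measurable (fun ω => ?_)
      fun s => measurable_const.ite hNm (hB.measurable s)
    by_cases h : ω ∈ N
    · simp [B', h, continuous_const]
    · simpa [B', h] using not_not.1 fun hc => h (hN hc)
  have hae : ∀ᵐ s ∂volume.restrict (Ioi (0 : ℝ)), ∀ᵐ ω ∂P, B' s ω ≠ 0 := by
    filter_upwards [ae_restrict_mem measurableSet_Ioi] with s hs
    filter_upwards [hB.ae_ne_zero hs, hNae] with ω h1 h2
    simpa [B', h2] using h1
  have hset : MeasurableSet {p : ℝ × Ω | B' p.1 p.2 ≠ 0} :=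
    (hB' (measurableSet_singleton 0)).compl
  filter_upwards [(Measure.ae_ae_comm hset).1 hae, hNae] with ω h1 h2
  simpa [B', h2] using h1

/-- Almost surely, the proportion of grid times at which Brownian motion is positive converges to
the proportion of time it spends in the positive half-line. -/
lemma ae_tendsto_positiveCount_div (hB : IsBrownianMotion P B) {t : ℝ} (ht : 0 < t) :
    ∀ᵐ ω ∂P, Tendsto (fun n : ℕ =>
        (positiveCount n fun i : ℕ => B ((i + 1 : ℕ) * (t / n)) ω - B (i * (t / n)) ω : ℝ) / n)
      atTop (nhds (sojourn B t ω / t)) := by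
  filter_upwards [hB.start, hB.cont, hB.ae_ae_ne_zero] with ω h0 hc hne
  set f : ℝ → ℝ := fun s => if 0 < B (t * s) ω then 1 else 0
  have hsoj : sojourn B t ω / t = ∫ s in (0 : ℝ)..1, f s := by
    have := intervalIntegral.integral_comp_mul_left (a := 0) (b := 1)
      (fun s => if 0 < B s ω then (1 : ℝ) else 0) ht.ne'
    rw [this, mul_zero, mul_one, smul_eq_mul, sojourn, div_eq_inv_mul]
  have hct : Continuous fun s => B (t * s) ω := hc.comp (by fun_prop)
  have hf : Measurable f := Measurable.ite (measurableSet_lt measurable_const hct.measurable)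
    measurable_const measurable_const
  have hcont : ∀ᵐ s ∂volume.restrict (Ioc (0 : ℝ) 1), ContinuousAt f s := by
    have hne' : ∀ᵐ s ∂volume.restrict (Ioi (0 : ℝ)), B (t * s) ω ≠ 0 := by
      rw [ae_restrict_iff' measurableSet_Ioi] at hne ⊢
      have hq : Measure.QuasiMeasurePreserving (fun s : ℝ => t * s) volume volume :=
        ⟨by fun_prop, by
          rw [Real.map_volume_mul_left ht.ne']
          exact Measure.smul_absolutelyContinuous⟩
      filter_upwards [hq.ae hne] with s hs hs0
      exact hs (mul_pos ht hs0)
    filter_upwards [ae_restrict_of_ae_restrict_of_subset Ioc_subset_Ioi_self hne'] with s hs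
    rcases lt_or_gt_of_ne hs with h | h
    · have : ∀ᶠ r in nhds s, f r = 0 := by
        filter_upwards [hct.continuousAt.eventually_lt_const h] with r hr
        simp [f, hr.le]
      exact continuousAt_const.congr (this.mono fun _ h => h.symm)
    · have : ∀ᶠ r in nhds s, f r = 1 := by
        filter_upwards [hct.continuousAt.eventually_const_lt h] with r hr
        simp [f, hr]
      exact continuousAt_const.congr (this.mono fun _ h => h.symm)
  rw [hsoj]
  refine (tendsto_riemannSum_of_ae_continuousAt (C := 1) hf (fun s => ?_) hcont).congr fun n => ?_
  · by_cases h : 0 < B (t * s) ω <;> simp [f, h]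
  · congr 1
    simp only [positiveCount, f, partialSum_increments (fun s => B s ω), h0, sub_zero, Finset.sum_boole]
    congr! 4 with j
    field_simp

/-- The proportion of time that Brownian motion spends in the positive half-line follows the
arcsine distribution. -/
lemma map_sojourn_div (hB : IsBrownianMotion P B) {t : ℝ} (ht : 0 < t) :
    AEMeasurable (fun ω => sojourn B t ω / t) P ∧
      P.map (fun ω => sojourn B t ω / t) = arcsineMeasure := by
  set X : ℕ → Ω → ℕ → ℝ := fun n ω i => B ((i + 1 : ℕ) * (t / n)) ω - B (i * (t / n)) ω
  have hX : ∀ n, Measurable (X n) := fun n =>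
    measurable_pi_lambda _ fun i => (hB.measurable _).sub (hB.measurable _)
  have hXn : ∀ n : ℕ, Measurable fun ω => (positiveCount n (X n ω) : ℝ) / n := fun n =>
    (measurable_from_top.comp ((measurable_positiveCount n).comp (hX n))).div_const _
  have hlim := hB.ae_tendsto_positiveCount_div ht
  have hA : AEMeasurable (fun ω => sojourn B t ω / t) P :=
    aemeasurable_of_tendsto_metrizable_ae atTop (fun n => (hXn n).aemeasurable) hlim
  refine ⟨hA, ?_⟩
  have := Measure.isProbabilityMeasure_map hA
  refine ext_of_forall_integral_eq_of_IsFiniteMeasure fun f => ?_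
  rw [integral_map hA f.continuous.aestronglyMeasurable]
  have hlim1 : Tendsto (fun n : ℕ => ∫ ω, f ((positiveCount n (X n ω) : ℝ) / n) ∂P) atTop
      (nhds (∫ ω, f (sojourn B t ω / t) ∂P)) := by
    refine tendsto_integral_of_dominated_convergence (fun _ => ‖f‖)
      (fun n => (f.continuous.measurable.comp (hXn n)).aestronglyMeasurable)
      (integrable_const _) (fun n => .of_forall fun ω => f.norm_coe_le_norm _) ?_
    filter_upwards [hlim] with ω hω
    exact (f.continuous.tendsto _).comp hω
  refine tendsto_nhds_unique hlim1 ((tendsto_sum_halfCoeff f.toContinuousMap).congr' ?_)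
  filter_upwards [eventually_gt_atTop 0] with n hn
  have htn : 0 < t / n := div_pos ht (Nat.cast_pos.2 hn)
  have hv : (t / n).toNNReal ≠ 0 := by simpa using htn
  have := nullSingletonClass_gaussianReal (μ := 0) hv
  have hsymm : (gaussianReal 0 (t / n).toNNReal).map (fun a => -a) =
      gaussianReal 0 (t / n).toNNReal := by
    rw [gaussianReal_map_neg, neg_zero]
  have hsum := integral_positiveCount_eq_sum _ hsymm n fun k => f ((k : ℝ) / n)
  refine hsum.symm.trans ?_
  rw [← hB.map_increments htn.le]
  exact integral_map (hX n).aemeasurable (f.continuous.measurable.comp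
    ((measurable_from_top.comp (measurable_positiveCount n)).div_const _)).aestronglyMeasurable

end IsBrownianMotion

/-- **Lévy's second arcsine law for Brownian motion.** For every `t > 0`, the
proportion `A_t / t` of time that Brownian motion spends above zero is arcsine
distributed: `P(A_t/t ≤ x) = (2/π) arcsin(√x)` for `x ∈ [0,1]`; equivalently,
`A_t/t` has density `x ↦ 1/(π √(x(1-x)))` on `(0,1)`. -/
theorem arcsine_law_brownian_motion (P : Measure Ω) [IsProbabilityMeasure P]
    (B : ℝ → Ω → ℝ) (hB : IsBrownianMotion P B) (t : ℝ) (ht : 0 < t) :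
    (∀ x ∈ Set.Icc (0:ℝ) 1,
      P {ω | sojourn B t ω / t ≤ x} = ENNReal.ofReal (2 / π * Real.arcsin (Real.sqrt x))) ∧
    P.map (fun ω => sojourn B t ω / t) =
      volume.withDensity fun x =>
        ENNReal.ofReal (if x ∈ Set.Ioo (0:ℝ) 1 then 1 / (π * Real.sqrt (x * (1 - x))) else 0) := by
  obtain ⟨hA, hmap⟩ := hB.map_sojourn_div ht
  refine ⟨fun x hx => ?_, hmap⟩
  rw [← arcsineMeasure_Iic hx, ← hmap, Measure.map_apply_of_aemeasurable hA measurableSet_Iic]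
  rfl

end
end

section
/- Let X be a Lévy process with positive sojourn time A_t. Then for all q, λ > 0 the double Laplace transform satisfies G(q, λ) := ∫_0^∞ e^{−qt} E[exp(−λ A_t)] dt = q^{−1} · exp( − ∫_0^∞ e^{−qt} t^{−1} P(X_t > 0) (1 − e^{−λ t}) dt ). -/
open MeasureTheory ProbabilityTheory Real Set Filter

noncomputable section

variable {Ω : Type*} [MeasurableSpace Ω]

/-- A real-valued Lévy process issued from the origin: càdlàg paths a.s.,
`X 0 = 0` a.s., stationary increments, and increments independent of the past. -/
structure IsLevyProcess (P : Measure Ω) (X : ℝ → Ω → ℝ) : Prop where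
  measurable : ∀ t, Measurable (X t)
  start : ∀ᵐ ω ∂P, X 0 ω = 0
  cadlag : ∀ᵐ ω ∂P, ∀ t : ℝ, 0 ≤ t →
      ContinuousWithinAt (fun s => X s ω) (Set.Ici t) t ∧
      (0 < t → ∃ l : ℝ, Filter.Tendsto (fun s => X s ω) (nhdsWithin t (Set.Iio t)) (nhds l))
  stationary : ∀ s t : ℝ, 0 ≤ s → s ≤ t →
      P.map (fun ω => X t ω - X s ω) = P.map (X (t - s))
  indep : ∀ s t : ℝ, 0 ≤ s → s ≤ t → ∀ (n : ℕ) (u : Fin n → ℝ),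
      (∀ i, 0 ≤ u i ∧ u i ≤ s) →
      IndepFun (fun ω => X t ω - X s ω) (fun ω (i : Fin n) => X (u i) ω) P

open scoped NNReal

/-- Two processes with the same initial law, the same laws of increments, and increments
independent of the past have the same finite-dimensional distributions. -/
lemma map_restrict_eq_of_indep_increments {Ω' : Type*} [MeasurableSpace Ω']
    {P : Measure Ω} {P' : Measure Ω'} [IsProbabilityMeasure P] [IsProbabilityMeasure P']
    {Y : ℝ≥0 → Ω → ℝ} {Y' : ℝ≥0 → Ω' → ℝ}
    (hY : ∀ t, Measurable (Y t)) (hY' : ∀ t, Measurable (Y' t))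
    (h0 : P.map (Y 0) = P'.map (Y' 0))
    (hinc : ∀ s t, s ≤ t →
      P.map (fun ω => Y t ω - Y s ω) = P'.map (fun ω => Y' t ω - Y' s ω))
    (hind : ∀ s t, s ≤ t → ∀ J : Finset ℝ≥0, (∀ u ∈ J, u ≤ s) →
      IndepFun (fun ω => Y t ω - Y s ω) (fun ω (i : J) => Y i ω) P)
    (hind' : ∀ s t, s ≤ t → ∀ J : Finset ℝ≥0, (∀ u ∈ J, u ≤ s) →
      IndepFun (fun ω => Y' t ω - Y' s ω) (fun ω (i : J) => Y' i ω) P')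
    (I : Finset ℝ≥0) :
    P.map (fun ω (i : I) => Y i ω) = P'.map (fun ω (i : I) => Y' i ω) := by
  have sub : ∀ I J : Finset ℝ≥0, I ⊆ J →
      P.map (fun ω (i : J) => Y i ω) = P'.map (fun ω (i : J) => Y' i ω) →
      P.map (fun ω (i : I) => Y i ω) = P'.map (fun ω (i : I) => Y' i ω) := by
    intro I J hIJ h
    have hm : Measurable (fun (p : J → ℝ) (i : I) => p ⟨i, hIJ i.2⟩) := by fun_prop
    have := congrArg (Measure.map (fun (p : J → ℝ) (i : I) => p ⟨i, hIJ i.2⟩)) h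
    rwa [Measure.map_map hm (by fun_prop), Measure.map_map hm (by fun_prop)] at this
  suffices h : P.map (fun ω (i : (insert 0 I : Finset ℝ≥0)) => Y i ω)
      = P'.map (fun ω (i : (insert 0 I : Finset ℝ≥0)) => Y' i ω) from
    sub _ _ (Finset.subset_insert _ _) h
  induction I using Finset.induction_on_max with
  | empty =>
    have hm : Measurable (fun (x : ℝ) (_ : (insert 0 ∅ : Finset ℝ≥0)) => x) := by fun_prop
    have := congrArg (Measure.map (fun (x : ℝ) (_ : (insert 0 ∅ : Finset ℝ≥0)) => x)) h0
    rw [Measure.map_map hm (hY 0), Measure.map_map hm (hY' 0)] at this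
    convert this using 2
    all_goals
      funext ω i
      have : (i : ℝ≥0) = 0 := by simpa using i.2
      simp [this]
  | insert a I ha ih =>
    set J : Finset ℝ≥0 := insert 0 I with hJ
    have hJne : J.Nonempty := ⟨0, by simp [hJ]⟩
    set m := J.max' hJne with hm
    have hmJ : m ∈ J := J.max'_mem hJne
    have hma : m ≤ a := by
      rcases Finset.mem_insert.1 hmJ with h | h
      · rw [h]; exact zero_le
      · exact (ha m h).le
    have hle : ∀ u ∈ J, u ≤ m := fun u hu => J.le_max' u hu
    have hJK : ∀ i : (insert 0 (insert a I) : Finset ℝ≥0), (i : ℝ≥0) ∉ J → (i : ℝ≥0) = a := by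
      rintro ⟨i, hi⟩ h
      simp only [hJ, Finset.mem_insert] at hi h
      tauto
    let Φ : ℝ × (J → ℝ) → ((insert 0 (insert a I) : Finset ℝ≥0) → ℝ) := fun z i =>
      if h : (i : ℝ≥0) ∈ J then z.2 ⟨i, h⟩ else z.1 + z.2 ⟨m, hmJ⟩
    have hΦ : Measurable Φ := by
      refine measurable_pi_lambda _ fun i => ?_
      by_cases h : (i : ℝ≥0) ∈ J
      · simp only [Φ, h, dite_true]; fun_prop
      · simp only [Φ, h, dite_false]; fun_prop
    have e1 := (indepFun_iff_map_prod_eq_prod_map_map (by fun_prop) (by fun_prop)).1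
      (hind m a hma J hle)
    have e2 := (indepFun_iff_map_prod_eq_prod_map_map (by fun_prop) (by fun_prop)).1
      (hind' m a hma J hle)
    rw [hinc m a hma, ih, ← e2] at e1
    have := congrArg (Measure.map Φ) e1
    rw [Measure.map_map hΦ (by fun_prop), Measure.map_map hΦ (by fun_prop)] at this
    convert this using 2
    all_goals
      funext ω i
      by_cases h : (i : ℝ≥0) ∈ J
      · simp [Φ, h]
      · simp [Φ, hJK i h]

lemma indepFun_snd_prod {Ω' α β : Type*} [MeasurableSpace Ω'] [MeasurableSpace α]
    [MeasurableSpace β] {P : Measure Ω} {P' : Measure Ω'} [IsProbabilityMeasure P]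
    [IsProbabilityMeasure P'] {f : Ω → α} {g : Ω → β} (hf : Measurable f) (hg : Measurable g)
    (h : IndepFun f g P) :
    IndepFun (fun z : Ω' × Ω => f z.2) (fun z : Ω' × Ω => (z.1, g z.2)) (P'.prod P) := by
  rw [indepFun_iff_measure_inter_preimage_eq_mul]
  intro s t hs ht
  have hF : Measurable (fun z : Ω' × Ω => f z.2) := hf.comp measurable_snd
  have hG : Measurable (fun z : Ω' × Ω => (z.1, g z.2)) :=
    measurable_fst.prodMk (hg.comp measurable_snd)
  rw [Measure.prod_apply ((hF hs).inter (hG ht)), Measure.prod_apply (hG ht)]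
  have e1 : (P'.prod P) ((fun z : Ω' × Ω => f z.2) ⁻¹' s) = P (f ⁻¹' s) := by
    have : (fun z : Ω' × Ω => f z.2) ⁻¹' s = univ ×ˢ (f ⁻¹' s) := by ext; simp
    rw [this, Measure.prod_prod]; simp
  rw [e1, ← lintegral_const_mul _ (measurable_measure_prodMk_left (hG ht))]
  refine lintegral_congr fun ω' => ?_
  exact h.measure_inter_preimage_eq_mul s (Prod.mk ω' ⁻¹' t) hs (measurable_prodMk_left ht)

lemma IsLevyProcess.indepFun_finset {P : Measure Ω} {X : ℝ → Ω → ℝ} (hX : IsLevyProcess P X)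
    {s t : ℝ} (hs : 0 ≤ s) (hst : s ≤ t) {ι : Type*} [Fintype ι] (u : ι → ℝ)
    (hu : ∀ i, 0 ≤ u i ∧ u i ≤ s) :
    IndepFun (fun ω => X t ω - X s ω) (fun ω (i : ι) => X (u i) ω) P := by
  have e := (Fintype.equivFin ι)
  have h := hX.indep s t hs hst _ (u ∘ e.symm) fun i => hu _
  have := h.comp (φ := id) (ψ := fun (p : Fin (Fintype.card ι) → ℝ) (i : ι) => p (e i))
    measurable_id (by fun_prop)
  simpa [Function.comp_def] using this

/-- The law of the process after time `s` is that of an independent copy started at `X s`. -/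
lemma IsLevyProcess.map_shift_eq {P : Measure Ω} [IsProbabilityMeasure P] {X : ℝ → Ω → ℝ}
    (hX : IsLevyProcess P X) {s : ℝ} (hs : 0 ≤ s) :
    P.map (fun ω (u : ℝ≥0) => X (s + u) ω)
      = (P.prod P).map (fun z (u : ℝ≥0) => X s z.1 + X u z.2) := by
  have hm := hX.measurable
  have hm2 : ∀ u : ℝ≥0, Measurable (fun z : Ω × Ω => X s z.1 + X u z.2) := fun u =>
    ((hm s).comp measurable_fst).add ((hm u).comp measurable_snd)
  have hfdd := map_restrict_eq_of_indep_increments (P := P) (P' := P.prod P)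
    (Y := fun u ω => X (s + u) ω) (Y' := fun u z => X s z.1 + X u z.2)
    (fun u => hm _) hm2 ?_ ?_ ?_ ?_
  · have h1 : IsProjectiveLimit (P.map (fun ω (u : ℝ≥0) => X (s + u) ω))
        (fun I => P.map (fun ω (i : I) => X (s + (i : ℝ≥0)) ω)) :=
      isProjectiveLimit_map (X := fun (u : ℝ≥0) ω => X (s + u) ω)
        (measurable_pi_lambda _ fun u => hm _).aemeasurable
    have h2 : IsProjectiveLimit ((P.prod P).map (fun z (u : ℝ≥0) => X s z.1 + X u z.2))
        (fun I => (P.prod P).map (fun z (i : I) => X s z.1 + X (i : ℝ≥0) z.2)) :=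
      isProjectiveLimit_map (X := fun (u : ℝ≥0) (z : Ω × Ω) => X s z.1 + X u z.2)
        (measurable_pi_lambda _ fun u => hm2 _).aemeasurable
    simp_rw [hfdd] at h1
    exact h1.unique h2
  · have h0 : (fun z : Ω × Ω => X s z.1 + X (0 : ℝ≥0) z.2) =ᵐ[P.prod P] fun z => X s z.1 := by
      filter_upwards [Measure.quasiMeasurePreserving_snd.ae hX.start] with z hz
      simp [hz]
    have : (fun z : Ω × Ω => X s z.1) = X s ∘ Prod.fst := rfl
    rw [Measure.map_congr h0, this, ← Measure.map_map (hm s) measurable_fst, Measure.map_fst_prod]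
    simp
  · intro r t hrt
    have hrt' : (r : ℝ) ≤ t := hrt
    have e : (fun z : Ω × Ω => X s z.1 + X t z.2 - (X s z.1 + X r z.2))
        = (fun ω => X t ω - X r ω) ∘ Prod.snd := by ext z; simp
    rw [e, ← Measure.map_map (by fun_prop) measurable_snd, Measure.map_snd_prod,
      hX.stationary _ _ (by positivity) (by linarith), measure_univ, one_smul,
      hX.stationary _ _ r.coe_nonneg hrt']
    congr 2; ring
  · intro r t hrt J hJ
    have hrt' : (r : ℝ) ≤ t := hrt
    exact hX.indepFun_finset (by positivity) (by linarith) (fun i : J => s + (i : ℝ≥0))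
      fun i => ⟨by positivity, by have : ((i : ℝ≥0) : ℝ) ≤ r := hJ i i.2
                                  linarith⟩
  · intro r t hrt J hJ
    have hrt' : (r : ℝ) ≤ t := hrt
    have h := indepFun_snd_prod (P' := P) ((hm t).sub (hm r)) (by fun_prop)
      (hX.indepFun_finset r.coe_nonneg hrt' (fun i : J => ((i : ℝ≥0) : ℝ))
        fun i => ⟨(i : ℝ≥0).2, hJ i i.2⟩)
    have h' := h.comp (φ := id) (ψ := fun (w : Ω × (J → ℝ)) (i : J) => X s w.1 + w.2 i)
      measurable_id (by fun_prop)
    have e : (fun z : Ω × Ω => X s z.1 + X t z.2 - (X s z.1 + X r z.2))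
        = (fun z => X t z.2 - X r z.2) := by ext z; simp
    rw [e]
    exact h'

/-- The value at `u` of a right-continuous path, recovered from its values at rational times. -/
def rightValue (u : ℝ≥0) (p : ℝ≥0 → ℝ) : ℝ :=
  limsup (fun n : ℕ => p ((⌊(n + 1) * u⌋₊ + 1) / (n + 1))) atTop

lemma measurable_rightValue : Measurable (fun z : ℝ≥0 × (ℝ≥0 → ℝ) => rightValue z.1 z.2) := by
  refine Measurable.limsup fun n => ?_
  have h1 : Measurable (fun w : ℕ × (ℝ≥0 → ℝ) => w.2 ((w.1 + 1) / (n + 1))) :=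
    measurable_from_prod_countable_right fun k =>
      measurable_pi_apply (((k : ℝ≥0) + 1) / (n + 1))
  have h2 : Measurable (fun z : ℝ≥0 × (ℝ≥0 → ℝ) => (⌊((n : ℝ≥0) + 1) * z.1⌋₊, z.2)) :=
    (Nat.measurable_floor.comp (measurable_fst.const_mul _)).prodMk measurable_snd
  exact h1.comp h2

lemma rightValue_eq {u : ℝ≥0} {p : ℝ≥0 → ℝ} (h : ContinuousWithinAt p (Ici u) u) :
    rightValue u p = p u := by
  refine Tendsto.limsup_eq (h.tendsto.comp (tendsto_nhdsWithin_iff.2 ⟨?_, ?_⟩))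
  · have key : ∀ n : ℕ, u ≤ (⌊((n : ℝ≥0) + 1) * u⌋₊ + 1) / (n + 1) ∧
        ((⌊((n : ℝ≥0) + 1) * u⌋₊ : ℝ≥0) + 1) / (n + 1) ≤ u + 1 / (n + 1) := by
      intro n
      have hn : (0 : ℝ≥0) < n + 1 := by positivity
      constructor
      · rw [le_div_iff₀ hn, mul_comm]
        exact (Nat.lt_floor_add_one _).le
      · rw [add_div]
        gcongr
        rw [div_le_iff₀ hn, mul_comm]
        exact Nat.floor_le zero_le
    refine tendsto_of_tendsto_of_tendsto_of_le_of_le tendsto_const_nhds ?_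
      (fun n => (key n).1) (fun n => (key n).2)
    have : Tendsto (fun n : ℕ => u + 1 / ((n : ℝ≥0) + 1)) atTop (nhds (u + 0)) :=
      tendsto_const_nhds.add tendsto_one_div_add_atTop_nhds_zero_nat
    simpa using this
  · refine Eventually.of_forall fun n => ?_
    have hn : (0 : ℝ≥0) < n + 1 := by positivity
    rw [mem_Ici, le_div_iff₀ hn, mul_comm]
    exact (Nat.lt_floor_add_one _).le

attribute [irreducible] rightValue

lemma measurable_sojourn {Z : ℝ → Ω → ℝ} (hZ : Measurable (Function.uncurry Z)) :
    Measurable (fun z : ℝ × Ω => sojourn Z z.1 z.2) := by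
  have hS : MeasurableSet {w : (ℝ × Ω) × ℝ | 0 < Z w.2 w.1.2} :=
    measurableSet_lt measurable_const
      (hZ.comp (measurable_snd.prodMk (measurable_snd.comp measurable_fst)))
  have key : ∀ T : Set ((ℝ × Ω) × ℝ), MeasurableSet T → Measurable (fun z : ℝ × Ω =>
      ∫ s, T.indicator (fun w => if 0 < Z w.2 w.1.2 then (1 : ℝ) else 0) (z, s)) := fun T hT =>
    (StronglyMeasurable.integral_prod_right'
      ((Measurable.ite hS measurable_const measurable_const).indicator hT).stronglyMeasurable
      ).measurable
  have h1 := key {w | w.2 ∈ Ioc 0 w.1.1}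
    ((measurableSet_lt measurable_const measurable_snd).inter
      (measurableSet_le measurable_snd (measurable_fst.comp measurable_fst)))
  have h2 := key {w | w.2 ∈ Ioc w.1.1 0}
    ((measurableSet_lt (measurable_fst.comp measurable_fst) measurable_snd).inter
      (measurableSet_le measurable_snd measurable_const))
  convert h1.sub h2 using 1
  funext z
  simp only [sojourn, intervalIntegral, Pi.sub_apply, ← integral_indicator measurableSet_Ioc]
  rfl

lemma intervalIntegrable_pos_indicator {f : ℝ → ℝ} (hf : Measurable f) (a b : ℝ) :
    IntervalIntegrable (fun s => if 0 < f s then (1 : ℝ) else 0) volume a b := by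
  refine (intervalIntegrable_const (c := (1 : ℝ))).mono_fun
    (Measurable.ite (measurableSet_lt measurable_const hf) measurable_const
      measurable_const).aestronglyMeasurable (Eventually.of_forall fun s => ?_)
  dsimp only
  split_ifs <;> simp

lemma sojourn_nonneg {S : Type*} (Z : ℝ → S → ℝ) {t : ℝ} (ht : 0 ≤ t) (ω : S) : 0 ≤ sojourn Z t ω :=
  intervalIntegral.integral_nonneg ht fun s _ => by split_ifs <;> norm_num

lemma exp_neg_mul_sojourn_le_one {S : Type*} (Z : ℝ → S → ℝ) {l t : ℝ} (hl : 0 ≤ l)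
    (ht : 0 ≤ t) (ω : S) :
    rexp (-l * sojourn Z t ω) ≤ 1 := by
  rw [exp_le_one_iff]
  nlinarith [sojourn_nonneg Z ht ω]

lemma sojourn_congr {S S' : Type*} {Z : ℝ → S → ℝ} {Z' : ℝ → S' → ℝ} {t : ℝ} (ht : 0 ≤ t)
    {ω : S} {ω' : S'} (h : ∀ s, 0 ≤ s → Z s ω = Z' s ω') : sojourn Z t ω = sojourn Z' t ω' := by
  refine intervalIntegral.integral_congr fun s hs => ?_
  rw [uIcc_of_le ht] at hs
  simp only [h s hs.1]

/-- A jointly measurable version of a process with right-continuous paths. -/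
def rightVersion (X : ℝ → Ω → ℝ) (t : ℝ) (ω : Ω) : ℝ :=
  rightValue t.toNNReal (fun u => X u ω)

lemma measurable_uncurry_rightVersion {X : ℝ → Ω → ℝ} (hX : ∀ t, Measurable (X t)) :
    Measurable (Function.uncurry (rightVersion X)) := by
  have : Measurable (fun z : ℝ × Ω => (z.1.toNNReal, fun u : ℝ≥0 => X u z.2)) :=
    (measurable_real_toNNReal.comp measurable_fst).prodMk
      (measurable_pi_lambda _ fun u => (hX u).comp measurable_snd)
  exact measurable_rightValue.comp this

lemma IsLevyProcess.ae_continuousWithinAt {P : Measure Ω} {X : ℝ → Ω → ℝ}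
    (hX : IsLevyProcess P X) :
    ∀ᵐ ω ∂P, ∀ s : ℝ, 0 ≤ s → ∀ u : ℝ≥0,
      ContinuousWithinAt (fun u : ℝ≥0 => X (s + u) ω) (Ici u) u := by
  filter_upwards [hX.cadlag] with ω hω s hs u
  refine ContinuousWithinAt.comp (t := Ici (s + u)) (g := fun t => X t ω)
    (hω (s + u) (by positivity)).1 (by fun_prop) fun v hv => ?_
  have : (u : ℝ) ≤ v := hv
  simpa using this

lemma IsLevyProcess.ae_rightVersion_eq {P : Measure Ω} {X : ℝ → Ω → ℝ}
    (hX : IsLevyProcess P X) :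
    ∀ᵐ ω ∂P, ∀ t : ℝ, 0 ≤ t → rightVersion X t ω = X t ω := by
  filter_upwards [hX.ae_continuousWithinAt] with ω hω t ht
  have := hω 0 le_rfl t.toNNReal
  simp only [zero_add] at this
  rw [rightVersion, rightValue_eq this, coe_toNNReal _ ht]

/-- The Markov property at a deterministic time, for the sojourn time functional. -/
lemma IsLevyProcess.integral_shift_sojourn {P : Measure Ω} [IsProbabilityMeasure P]
    {X : ℝ → Ω → ℝ} (hX : IsLevyProcess P X) {l s r : ℝ} (hl : 0 ≤ l) (hs : 0 ≤ s) (hr : 0 ≤ r)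
    (x : ℝ) :
    ∫ ω, (if 0 < x + rightVersion X s ω then (1 : ℝ) else 0)
        * rexp (-l * sojourn (fun u ω => x + rightVersion X (s + u) ω) r ω) ∂P
      = ∫ ω, (if 0 < x + rightVersion X s ω then (1 : ℝ) else 0)
        * ∫ ω', rexp (-l * sojourn (fun u ω' => x + rightVersion X s ω + rightVersion X u ω')
          r ω') ∂P ∂P := by
  have hm := hX.measurable
  set Z : ℝ → (ℝ≥0 → ℝ) → ℝ := fun u p => x + rightValue u.toNNReal p with hZdef
  have hZ : Measurable (Function.uncurry Z) :=
    (measurable_rightValue.comp ((measurable_real_toNNReal.comp measurable_fst).prodMk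
      measurable_snd)).const_add x
  set Φ : (ℝ≥0 → ℝ) → ℝ := fun p => (if 0 < Z 0 p then (1 : ℝ) else 0)
    * rexp (-l * sojourn Z r p) with hΦdef
  have hΦ : Measurable Φ := by
    refine (Measurable.ite (measurableSet_lt measurable_const (hZ.comp measurable_prodMk_left))
      measurable_const measurable_const).mul (measurable_exp.comp (Measurable.const_mul ?_ _))
    exact (measurable_sojourn hZ).comp measurable_prodMk_left
  have hΦ1 : ∀ p, ‖Φ p‖ ≤ 1 := fun p => by
    simp only [hΦdef, norm_mul, norm_of_nonneg (exp_nonneg _)]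
    split_ifs
    · simpa using mul_nonneg hl (sojourn_nonneg Z hr p)
    · simp
  have hm1 : Measurable (fun ω (u : ℝ≥0) => X (s + u) ω) := measurable_pi_lambda _ fun u => hm _
  have hm2 : Measurable (fun (z : Ω × Ω) (u : ℝ≥0) => X s z.1 + X u z.2) :=
    measurable_pi_lambda _ fun u =>
      ((hm s).comp measurable_fst).add ((hm u).comp measurable_snd)
  have hint : Integrable (fun z : Ω × Ω => Φ fun u : ℝ≥0 => X s z.1 + X u z.2) (P.prod P) :=
    Integrable.of_bound (hΦ.comp hm2).aestronglyMeasurable 1 (Eventually.of_forall fun z => hΦ1 _)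
  have law := congrArg (fun μ => ∫ p, Φ p ∂μ) (hX.map_shift_eq hs)
  rw [integral_map hm1.aemeasurable hΦ.aestronglyMeasurable,
    integral_map hm2.aemeasurable hΦ.aestronglyMeasurable,
    integral_prod _ hint] at law
  refine Eq.trans (integral_congr_ae ?_) (law.trans (integral_congr_ae ?_))
  · filter_upwards [hX.ae_continuousWithinAt, hX.ae_rightVersion_eq] with ω h1 h2
    have e : ∀ u : ℝ, 0 ≤ u →
        Z u (fun u : ℝ≥0 => X (s + u) ω) = x + rightVersion X (s + u) ω := fun u hu => by
      simp only [hZdef]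
      rw [rightValue_eq (h1 s hs _), h2 _ (by positivity), coe_toNNReal _ hu]
    simp only [hΦdef]
    rw [e 0 le_rfl, add_zero]
    congr 3
    exact sojourn_congr hr fun u hu => (e u hu).symm
  · filter_upwards [hX.ae_rightVersion_eq] with ω hω
    rw [← integral_const_mul]
    refine integral_congr_ae ?_
    filter_upwards [hX.ae_continuousWithinAt, hX.ae_rightVersion_eq, hX.start] with ω' h1 h2 h3
    have e : ∀ u : ℝ, 0 ≤ u → Z u (fun u : ℝ≥0 => X s ω + X u ω')
        = x + rightVersion X s ω + rightVersion X u ω' := fun u hu => by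
      have hc : ContinuousWithinAt (fun u : ℝ≥0 => X s ω + X u ω') (Ici u.toNNReal)
          u.toNNReal := by
        have := h1 0 le_rfl u.toNNReal
        simp only [zero_add] at this
        exact continuousWithinAt_const.add this
      simp only [hZdef]
      rw [rightValue_eq hc, hω s hs, h2 _ hu, coe_toNNReal _ hu, add_assoc]
    simp only [hΦdef]
    rw [e 0 le_rfl, h2 0 le_rfl, h3, add_zero]
    congr 3
    exact sojourn_congr hr fun u hu => e u hu

lemma one_sub_exp_neg_mul_integral {f : ℝ → ℝ} (hf : Measurable f) (l t : ℝ) :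
    1 - rexp (-l * ∫ s in (0 : ℝ)..t, if 0 < f s then (1 : ℝ) else 0)
      = l * ∫ s in (0 : ℝ)..t, (if 0 < f s then (1 : ℝ) else 0)
        * rexp (-l * ∫ u in (0 : ℝ)..(t - s), if 0 < f (s + u) then (1 : ℝ) else 0) := by
  set a : ℝ → ℝ := fun s => if 0 < f s then (1 : ℝ) else 0 with ha
  have hi : ∀ b c, IntervalIntegrable a volume b c := intervalIntegrable_pos_indicator hf
  have hloc : LocallyIntegrable a volume := by
    refine (locallyIntegrable_const (1 : ℝ)).mono
      (Measurable.ite (measurableSet_lt measurable_const hf) measurable_const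
        measurable_const).aestronglyMeasurable (Eventually.of_forall fun s => ?_)
    simp only [ha]
    split_ifs <;> simp
  set A : ℝ → ℝ := fun s => ∫ u in (0 : ℝ)..s, a u with hA
  have hAL : LipschitzWith 1 A := by
    refine LipschitzWith.of_dist_le_mul fun x y => ?_
    rw [dist_eq, hA]
    simp only
    rw [intervalIntegral.integral_interval_sub_left (hi _ _) (hi _ _)]
    have := intervalIntegral.norm_integral_le_of_norm_le_const (a := y) (b := x) (f := a) (C := 1)
      (fun s _ => by simp only [ha]; split_ifs <;> simp)
    simpa [dist_eq] using this
  set F : ℝ → ℝ := fun s => rexp (-l * (A t - A s)) with hF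
  have hFlip : LocallyLipschitz F := by
    have h1 : ContDiff ℝ 1 (fun y : ℝ => rexp (-l * (A t - y))) := by fun_prop
    exact h1.locallyLipschitz.comp hAL.locallyLipschitz
  obtain ⟨K, hK⟩ := hFlip.locallyLipschitzOn.exists_lipschitzOnWith_of_compact
    (isCompact_uIcc (a := (0 : ℝ)) (b := t))
  have hftc := hK.absolutelyContinuousOnInterval.integral_deriv_eq_sub
  have hF0 : F 0 = rexp (-l * A t) := by simp [hF, hA]
  have hFt : F t = 1 := by simp [hF]
  rw [hF0, hFt] at hftc
  rw [← hftc, ← intervalIntegral.integral_const_mul]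
  refine intervalIntegral.integral_congr_ae ?_
  filter_upwards [LocallyIntegrable.ae_hasDerivAt_integral hloc] with s hs _
  have hd : HasDerivAt F (rexp (-l * (A t - A s)) * (-l * (0 - a s))) s :=
    (((hasDerivAt_const s (A t)).sub (hs 0)).const_mul (-l)).exp
  have e : A t - A s = ∫ u in (0 : ℝ)..(t - s), a (s + u) := by
    rw [intervalIntegral.integral_comp_add_left, hA]
    simp only
    rw [intervalIntegral.integral_interval_sub_left (hi _ _) (hi _ _)]
    simp
  rw [hd.deriv, e]
  simp only [ha]
  ring

/-- Fubini's theorem on `{(s, t) | 0 < s < t}` in the coordinates `(s, t - s)`. -/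
lemma integral_Ioi_interval_sub {E : Type*} [NormedAddCommGroup E] [NormedSpace ℝ E]
    {F : ℝ → ℝ → E}
    (hF : Integrable (Function.uncurry F)
      ((volume.restrict (Ioi 0)).prod (volume.restrict (Ioi 0)))) :
    ∫ t in Ioi (0 : ℝ), ∫ s in (0 : ℝ)..t, F s (t - s)
      = ∫ s in Ioi (0 : ℝ), ∫ r in Ioi (0 : ℝ), F s r := by
  have hmp : MeasurePreserving (fun z : ℝ × ℝ => (z.1, z.1 + z.2))
      ((volume : Measure ℝ).prod volume) (volume.prod volume) := measurePreserving_prod_add _ _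
  set G : ℝ × ℝ → E := (Ioi (0 : ℝ) ×ˢ Ioi (0 : ℝ)).indicator (Function.uncurry F) with hG
  set H : ℝ × ℝ → E := fun z => G (z.1, z.2 - z.1) with hH
  have hS : MeasurableSet (Ioi (0 : ℝ) ×ˢ Ioi (0 : ℝ)) := measurableSet_Ioi.prod measurableSet_Ioi
  have hGi : Integrable G (volume.prod volume) := by
    rwa [hG, integrable_indicator_iff hS, IntegrableOn, ← Measure.prod_restrict]
  have hemb : MeasurableEmbedding (fun z : ℝ × ℝ => (z.1, z.1 + z.2)) :=
    (MeasurableEquiv.shearAddRight ℝ).measurableEmbedding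
  have hHG : H ∘ (fun z : ℝ × ℝ => (z.1, z.1 + z.2)) = G := by
    ext z; simp [hH]
  have hHi : Integrable H (volume.prod volume) := by
    rw [← hmp.integrable_comp_emb hemb, hHG]; exact hGi
  have e1 : ∫ z, H z ∂(volume.prod volume) = ∫ z, G z ∂(volume.prod volume) := by
    rw [← hmp.integral_comp hemb, ← hHG]; rfl
  rw [integral_prod_symm _ hHi, hG, integral_indicator hS, ← Measure.prod_restrict,
    integral_prod _ hF] at e1
  refine Eq.trans ?_ e1
  rw [← integral_indicator measurableSet_Ioi]
  refine integral_congr_ae (Eventually.of_forall fun t => ?_)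
  simp only [hH, hG]
  by_cases ht : 0 < t
  · rw [indicator_of_mem (mem_Ioi.2 ht), intervalIntegral.integral_of_le ht.le,
      integral_Ioc_eq_integral_Ioo, ← integral_indicator measurableSet_Ioo]
    congr 1
    ext s
    simp [indicator, Function.uncurry]
  · rw [indicator_of_notMem (by simpa using ht)]
    symm
    refine integral_eq_zero_of_ae (Eventually.of_forall fun s => ?_)
    refine indicator_of_notMem (fun hs => ?_) _
    simp only [mem_prod, mem_Ioi] at hs
    exact ht (by linarith)

/-- The double Laplace transform of the sojourn time for the process started at `x`. -/
def sojournTransform (P : Measure Ω) (Y : ℝ → Ω → ℝ) (q l x : ℝ) : ℝ :=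
  ∫ t in Ioi (0 : ℝ), rexp (-q * t) * ∫ ω, rexp (-l * sojourn (fun u ω => x + Y u ω) t ω) ∂P

lemma integrableOn_exp_neg_mul_Ioi {q : ℝ} (hq : 0 < q) :
    IntegrableOn (fun t => rexp (-q * t)) (Ioi 0) :=
  integrableOn_exp_mul_Ioi (by linarith) 0

lemma integral_exp_neg_mul_Ioi_zero {q : ℝ} (hq : 0 < q) :
    ∫ t in Ioi (0 : ℝ), rexp (-q * t) = q⁻¹ := by
  rw [integral_exp_mul_Ioi (by linarith) 0]
  simp [neg_div_neg_eq]

lemma measurable_laplace_sojourn {P : Measure Ω} [IsProbabilityMeasure P] {Y : ℝ → Ω → ℝ}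
    (hY : Measurable (Function.uncurry Y)) {l : ℝ} :
    Measurable (fun z : ℝ × ℝ =>
      ∫ ω, rexp (-l * sojourn (fun u ω => z.1 + Y u ω) z.2 ω) ∂P) := by
  have h : Measurable (fun w : ℝ × (ℝ × Ω) =>
      sojourn (fun u (p : ℝ × Ω) => p.1 + Y u p.2) w.1 w.2) := measurable_sojourn <|
    (measurable_fst.comp measurable_snd).add
      (hY.comp (measurable_fst.prodMk (measurable_snd.comp measurable_snd)))
  have h2 : Measurable (fun w : (ℝ × ℝ) × Ω =>
      rexp (-l * sojourn (fun u ω => w.1.1 + Y u ω) w.1.2 w.2)) :=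
    measurable_exp.comp (Measurable.const_mul (h.comp
      ((measurable_snd.comp measurable_fst).prodMk
        ((measurable_fst.comp measurable_fst).prodMk measurable_snd))) _)
  exact (h2.stronglyMeasurable.integral_prod_right' (ν := P)).measurable

lemma norm_laplace_sojourn_le {P : Measure Ω} [IsProbabilityMeasure P] {Y : ℝ → Ω → ℝ}
    {l : ℝ} (hl : 0 ≤ l) {t : ℝ} (ht : 0 ≤ t) (x : ℝ) :
    ‖∫ ω, rexp (-l * sojourn (fun u ω => x + Y u ω) t ω) ∂P‖ ≤ 1 := by
  refine (norm_integral_le_of_norm_le_const (C := 1) (Eventually.of_forall fun ω => ?_)).trans ?_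
  · rw [norm_of_nonneg (exp_nonneg _)]
    exact exp_neg_mul_sojourn_le_one _ hl ht ω
  · simp

lemma measurable_sojournTransform {P : Measure Ω} [IsProbabilityMeasure P] {Y : ℝ → Ω → ℝ}
    (hY : Measurable (Function.uncurry Y)) {q l : ℝ} : Measurable (sojournTransform P Y q l) := by
  have h : Measurable (fun z : ℝ × ℝ => rexp (-q * z.2) *
      ∫ ω, rexp (-l * sojourn (fun u ω => z.1 + Y u ω) z.2 ω) ∂P) :=
    (by fun_prop : Measurable fun z : ℝ × ℝ => rexp (-q * z.2)).mul
      (measurable_laplace_sojourn hY)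
  exact (h.stronglyMeasurable.integral_prod_right' (ν := volume.restrict (Ioi 0))).measurable

lemma norm_sojournTransform_le {P : Measure Ω} [IsProbabilityMeasure P] {Y : ℝ → Ω → ℝ}
    {q l : ℝ} (hq : 0 < q) (hl : 0 ≤ l) (x : ℝ) : ‖sojournTransform P Y q l x‖ ≤ q⁻¹ := by
  rw [← integral_exp_neg_mul_Ioi_zero hq]
  refine norm_integral_le_of_norm_le (integrableOn_exp_neg_mul_Ioi hq) ?_
  filter_upwards [ae_restrict_mem measurableSet_Ioi] with t ht
  rw [norm_mul, norm_of_nonneg (exp_nonneg _)]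
  exact mul_le_of_le_one_right (exp_nonneg _) (norm_laplace_sojourn_le hl (mem_Ioi.1 ht).le x)

/-- The renewal equation for the double Laplace transform, a consequence of the Markov property. -/
lemma sojournTransform_eq_sub {P : Measure Ω} [IsProbabilityMeasure P] {Y : ℝ → Ω → ℝ}
    (hY : Measurable (Function.uncurry Y)) {q l : ℝ} (hq : 0 < q) (hl : 0 ≤ l) (x : ℝ)
    (hM : ∀ s r : ℝ, 0 ≤ s → 0 ≤ r →
      ∫ ω, (if 0 < x + Y s ω then (1 : ℝ) else 0)
        * rexp (-l * sojourn (fun u ω => x + Y (s + u) ω) r ω) ∂P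
      = ∫ ω, (if 0 < x + Y s ω then (1 : ℝ) else 0)
        * ∫ ω', rexp (-l * sojourn (fun u ω' => x + Y s ω + Y u ω') r ω') ∂P ∂P) :
    sojournTransform P Y q l x = q⁻¹ - l * ∫ s in Ioi (0 : ℝ), rexp (-q * s) *
      ∫ ω, (if 0 < x + Y s ω then (1 : ℝ) else 0) * sojournTransform P Y q l (x + Y s ω) ∂P := by
  set g : ℝ → ℝ → ℝ := fun t y => ∫ ω, rexp (-l * sojourn (fun u ω => y + Y u ω) t ω) ∂P with hg
  set a : ℝ → Ω → ℝ := fun s ω => if 0 < x + Y s ω then (1 : ℝ) else 0 with ha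
  have hYs : ∀ ω, Measurable (fun s => Y s ω) := fun ω => hY.comp measurable_prodMk_right
  have ha01 : ∀ s ω, ‖a s ω‖ ≤ 1 := fun s ω => by simp only [ha]; split_ifs <;> simp
  have ham : Measurable (Function.uncurry a) :=
    Measurable.ite (measurableSet_lt measurable_const (hY.const_add x)) measurable_const
      measurable_const
  set h : ℝ → ℝ → Ω → ℝ := fun s r ω =>
    a s ω * rexp (-l * sojourn (fun u ω => x + Y (s + u) ω) r ω) with hh
  have hhm : Measurable (fun w : (ℝ × ℝ) × Ω => h w.1.1 w.1.2 w.2) := by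
    have h1 : Measurable (fun w : ℝ × (ℝ × Ω) =>
        sojourn (fun u (p : ℝ × Ω) => x + Y (p.1 + u) p.2) w.1 w.2) := measurable_sojourn <|
      (hY.comp (((measurable_fst.comp measurable_snd).add measurable_fst).prodMk
        (measurable_snd.comp measurable_snd))).const_add x
    exact (ham.comp ((measurable_fst.comp measurable_fst).prodMk measurable_snd)).mul
      (measurable_exp.comp (Measurable.const_mul (h1.comp
        ((measurable_snd.comp measurable_fst).prodMk
          ((measurable_fst.comp measurable_fst).prodMk measurable_snd))) _))
  have hh1 : ∀ s r ω, 0 ≤ r → ‖h s r ω‖ ≤ 1 := fun s r ω hr => by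
    rw [hh, norm_mul, norm_of_nonneg (exp_nonneg _)]
    exact mul_le_one₀ (ha01 s ω) (exp_nonneg _) (exp_neg_mul_sojourn_le_one _ hl hr ω)
  set m : ℝ → ℝ → ℝ := fun s r => ∫ ω, h s r ω ∂P with hm
  have hmm : Measurable (Function.uncurry m) :=
    (hhm.stronglyMeasurable.integral_prod_right' (ν := P)).measurable
  have hm1 : ∀ s r, 0 ≤ r → ‖m s r‖ ≤ 1 := fun s r hr => by
    refine (norm_integral_le_of_norm_le_const (C := 1)
      (Eventually.of_forall fun ω => hh1 s r ω hr)).trans ?_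
    simp
  have hgm : Measurable (fun z : ℝ × ℝ => g z.2 z.1) := measurable_laplace_sojourn hY
  have hexpint := integrableOn_exp_neg_mul_Ioi hq
  -- the pathwise identity, averaged
  have step1 : ∀ t, 0 < t → 1 - g t x = l * ∫ s in (0 : ℝ)..t, m s (t - s) := by
    intro t ht
    have e1 : 1 - g t x = ∫ ω, (1 - rexp (-l * sojourn (fun u ω => x + Y u ω) t ω)) ∂P := by
      rw [integral_sub (integrable_const _) (Integrable.of_bound ?_ 1 ?_)]
      · simp [hg]
      · have : Measurable (fun z : ℝ × Ω => sojourn (fun u ω => x + Y u ω) z.1 z.2) :=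
          measurable_sojourn (hY.const_add x)
        exact (measurable_exp.comp
          ((this.comp measurable_prodMk_left).const_mul _)).aestronglyMeasurable
      · refine Eventually.of_forall fun ω => ?_
        rw [norm_of_nonneg (exp_nonneg _)]
        exact exp_neg_mul_sojourn_le_one _ hl ht.le ω
    rw [e1, ← intervalIntegral.integral_const_mul, intervalIntegral.integral_of_le ht.le]
    have e2 : ∀ ω, 1 - rexp (-l * sojourn (fun u ω => x + Y u ω) t ω)
        = ∫ s in Ioc 0 t, l * h s (t - s) ω := fun ω => by
      have := one_sub_exp_neg_mul_integral (f := fun s => x + Y s ω) ((hYs ω).const_add x) l t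
      rw [integral_const_mul, ← intervalIntegral.integral_of_le ht.le]
      exact this
    simp_rw [e2, hm, ← integral_const_mul]
    refine integral_integral_swap (Integrable.of_bound (C := l) ?_ ?_)
    · have : Measurable (fun z : Ω × ℝ => l * h z.2 (t - z.2) z.1) :=
        (hhm.comp ((measurable_snd.prodMk (measurable_const.sub measurable_snd)).prodMk
          measurable_fst)).const_mul l
      exact this.aestronglyMeasurable
    · have hs : ∀ᵐ z ∂(P.prod (volume.restrict (Ioc 0 t))), z.2 ∈ Ioc 0 t :=
        Measure.quasiMeasurePreserving_snd.ae (ae_restrict_mem measurableSet_Ioc)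
      filter_upwards [hs] with z hz
      simp only [Function.uncurry, norm_mul, norm_of_nonneg hl]
      exact mul_le_of_le_one_right hl (hh1 _ _ _ (by linarith [hz.2]))
  have hF : Integrable (Function.uncurry fun s r => rexp (-q * s) * rexp (-q * r) * m s r)
      ((volume.restrict (Ioi 0)).prod (volume.restrict (Ioi 0))) := by
    refine (hexpint.mul_prod hexpint).mono
      (Measurable.aestronglyMeasurable ((by fun_prop : Measurable fun z : ℝ × ℝ =>
        rexp (-q * z.1) * rexp (-q * z.2)).mul hmm)) ?_
    have hs : ∀ᵐ z ∂((volume.restrict (Ioi (0 : ℝ))).prod (volume.restrict (Ioi (0 : ℝ)))),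
        z.2 ∈ Ioi (0 : ℝ) :=
      Measure.quasiMeasurePreserving_snd.ae (ae_restrict_mem measurableSet_Ioi)
    filter_upwards [hs] with z hz
    simp only [Function.uncurry]
    rw [norm_mul]
    exact mul_le_of_le_one_right (norm_nonneg _) (hm1 _ _ (mem_Ioi.1 hz).le)
  have hgint : ∀ y, IntegrableOn (fun t => rexp (-q * t) * g t y) (Ioi 0) := fun y => by
    have hmeas : Measurable (fun t => rexp (-q * t) * g t y) :=
      (by fun_prop : Measurable fun t : ℝ => rexp (-q * t)).mul (hgm.comp measurable_prodMk_left)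
    refine Integrable.mono hexpint hmeas.aestronglyMeasurable ?_
    filter_upwards [ae_restrict_mem measurableSet_Ioi] with t ht
    rw [norm_mul]
    exact mul_le_of_le_one_right (norm_nonneg _) (norm_laplace_sojourn_le hl (mem_Ioi.1 ht).le y)
  have e3 : q⁻¹ - sojournTransform P Y q l x
      = ∫ t in Ioi (0 : ℝ), rexp (-q * t) * (1 - g t x) := by
    rw [← integral_exp_neg_mul_Ioi_zero hq, sojournTransform, ← integral_sub hexpint (hgint x)]
    simp_rw [mul_sub, mul_one]
  have e4 : ∫ t in Ioi (0 : ℝ), rexp (-q * t) * (1 - g t x)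
      = l * ∫ t in Ioi (0 : ℝ), ∫ s in (0 : ℝ)..t,
        rexp (-q * s) * rexp (-q * (t - s)) * m s (t - s) := by
    rw [← integral_const_mul]
    refine setIntegral_congr_fun measurableSet_Ioi fun t ht => ?_
    rw [step1 t ht, mul_left_comm, ← intervalIntegral.integral_const_mul]
    congr 2
    ext s
    rw [← Real.exp_add]
    congr 2
    ring
  rw [integral_Ioi_interval_sub hF] at e4
  have e5 : ∀ s ∈ Ioi (0 : ℝ), ∫ r in Ioi (0 : ℝ), rexp (-q * s) * rexp (-q * r) * m s r
      = rexp (-q * s) * ∫ ω, a s ω * sojournTransform P Y q l (x + Y s ω) ∂P := by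
    intro s hs
    simp_rw [mul_assoc]
    rw [integral_const_mul]
    congr 1
    have e6 : ∀ r ∈ Ioi (0 : ℝ), rexp (-q * r) * m s r
        = ∫ ω, a s ω * (rexp (-q * r) * g r (x + Y s ω)) ∂P := fun r hr => by
      simp only [hm, hh]
      rw [hM s r (mem_Ioi.1 hs).le (mem_Ioi.1 hr).le, ← integral_const_mul]
      congr 1
      ext ω
      rw [mul_left_comm]
    rw [setIntegral_congr_fun measurableSet_Ioi e6, integral_integral_swap]
    · simp_rw [integral_const_mul]
      rfl
    · have hmeas : Measurable (fun z : ℝ × Ω =>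
          a s z.2 * (rexp (-q * z.1) * g z.1 (x + Y s z.2))) := by
        have hYs' : Measurable (Y s) := hY.comp measurable_prodMk_left
        exact ((ham.comp measurable_prodMk_left).comp measurable_snd).mul
          ((by fun_prop : Measurable fun z : ℝ × Ω => rexp (-q * z.1)).mul
            (hgm.comp (((hYs'.comp measurable_snd).const_add x).prodMk measurable_fst)))
      refine (hexpint.mul_prod (integrable_const (1 : ℝ))).mono hmeas.aestronglyMeasurable ?_
      have hs : ∀ᵐ z ∂((volume.restrict (Ioi (0 : ℝ))).prod P), z.1 ∈ Ioi (0 : ℝ) :=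
        Measure.quasiMeasurePreserving_fst.ae (ae_restrict_mem measurableSet_Ioi)
      filter_upwards [hs] with z hz
      simp only [Function.uncurry, norm_mul, mul_one]
      have b1 := ha01 s z.2
      have b2 : ‖g z.1 (x + Y s z.2)‖ ≤ 1 := norm_laplace_sojourn_le hl (mem_Ioi.1 hz).le _
      calc ‖a s z.2‖ * (‖rexp (-q * z.1)‖ * ‖g z.1 (x + Y s z.2)‖)
          ≤ 1 * (‖rexp (-q * z.1)‖ * 1) := by gcongr
        _ = _ := by ring
  rw [setIntegral_congr_fun measurableSet_Ioi e5] at e4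
  linarith [e3, e4]

lemma sub_exp_div_nonneg {q l t : ℝ} (hl : 0 ≤ l) (ht : 0 < t) :
    0 ≤ (rexp (-q * t) - rexp (-(q + l) * t)) / t := by
  refine div_nonneg (sub_nonneg.2 (exp_le_exp.2 ?_)) ht.le
  nlinarith

lemma sub_exp_div_le {q l t : ℝ} (ht : 0 < t) :
    (rexp (-q * t) - rexp (-(q + l) * t)) / t ≤ l * rexp (-q * t) := by
  have h1 : rexp (-(q + l) * t) = rexp (-q * t) * rexp (-(l * t)) := by
    rw [← Real.exp_add]; ring_nf
  have h2 := add_one_le_exp (-(l * t))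
  have h3 := exp_pos (-q * t)
  rw [div_le_iff₀ ht, h1]
  nlinarith

lemma integrableOn_exp_mul_of_norm_le_one {φ : ℝ → ℂ} (hφ : Measurable φ) (hb : ∀ t, ‖φ t‖ ≤ 1)
    {a : ℝ} (ha : 0 < a) : IntegrableOn (fun t => (rexp (-a * t) : ℂ) * φ t) (Ioi 0) := by
  have hm : Measurable (fun t => (rexp (-a * t) : ℂ) * φ t) := by fun_prop
  refine Integrable.mono (integrableOn_exp_neg_mul_Ioi ha) hm.aestronglyMeasurable
    (Eventually.of_forall fun t => ?_)
  rw [norm_mul, Complex.norm_real]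
  exact mul_le_of_le_one_right (norm_nonneg _) (hb t)

/-- The resolvent identity for a scalar contraction semigroup. -/
lemma laplace_resolvent {φ : ℝ → ℂ} (hφ : Measurable φ) (hb : ∀ t, ‖φ t‖ ≤ 1)
    (hs : ∀ s t, 0 < s → 0 < t → φ (s + t) = φ s * φ t) {q l : ℝ} (hq : 0 < q) (hl : 0 ≤ l) :
    (l : ℂ) * ((∫ t in Ioi (0 : ℝ), (rexp (-(q + l) * t) : ℂ) * φ t)
        * ∫ t in Ioi (0 : ℝ), (rexp (-q * t) : ℂ) * φ t)
      = (∫ t in Ioi (0 : ℝ), (rexp (-q * t) : ℂ) * φ t)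
        - ∫ t in Ioi (0 : ℝ), (rexp (-(q + l) * t) : ℂ) * φ t := by
  have hi1 := integrableOn_exp_mul_of_norm_le_one hφ hb hq
  have hi2 := integrableOn_exp_mul_of_norm_le_one hφ hb (a := q + l) (by linarith)
  rw [← integral_sub hi1 hi2, ← integral_mul_const]
  simp_rw [← integral_const_mul ((rexp _ : ℂ) * φ _)]
  rw [← integral_Ioi_interval_sub (F := fun s r => (rexp (-(q + l) * s) : ℂ) * φ s
    * ((rexp (-q * r) : ℂ) * φ r)) (hi2.mul_prod hi1), ← integral_const_mul]
  refine setIntegral_congr_fun measurableSet_Ioi fun t ht => ?_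
  have ht : 0 < t := ht
  have e1 : ∫ s in (0 : ℝ)..t, (rexp (-(q + l) * s) : ℂ) * φ s
        * ((rexp (-q * (t - s)) : ℂ) * φ (t - s))
      = ∫ s in (0 : ℝ)..t, ((rexp (-l * s) : ℝ) : ℂ) * (rexp (-q * t) * φ t) := by
    rw [intervalIntegral.integral_of_le ht.le, intervalIntegral.integral_of_le ht.le,
      integral_Ioc_eq_integral_Ioo, integral_Ioc_eq_integral_Ioo]
    refine setIntegral_congr_fun measurableSet_Ioo fun s hst => ?_
    have h1 : φ t = φ s * φ (t - s) := by
      rw [← hs s (t - s) hst.1 (by linarith [hst.2])]; ring_nf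
    have h2 : rexp (-(q + l) * s) * rexp (-q * (t - s)) = rexp (-l * s) * rexp (-q * t) := by
      rw [← Real.exp_add, ← Real.exp_add]; ring_nf
    have h3 : (rexp (-(q + l) * s) : ℂ) * rexp (-q * (t - s)) = rexp (-l * s) * rexp (-q * t) := by
      exact_mod_cast h2
    rw [h1]
    linear_combination (φ s * φ (t - s)) * h3
  have e2 : l * ∫ s in (0 : ℝ)..t, rexp (-l * s) = 1 - rexp (-l * t) := by
    rcases eq_or_ne l 0 with rfl | hl0
    · simp
    · rw [intervalIntegral.integral_comp_mul_left (fun x => rexp x) (neg_ne_zero.2 hl0)]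
      simp only [mul_zero, integral_exp, smul_eq_mul, exp_zero]
      field_simp
      ring
  have e3 : rexp (-(q + l) * t) = rexp (-l * t) * rexp (-q * t) := by
    rw [← Real.exp_add]; ring_nf
  rw [e1, intervalIntegral.integral_mul_const, intervalIntegral.integral_ofReal, e3]
  have e4 : (l : ℂ) * ((∫ s in (0 : ℝ)..t, rexp (-l * s) : ℝ) : ℂ) = 1 - (rexp (-l * t) : ℂ) := by
    exact_mod_cast e2
  rw [Complex.ofReal_mul]
  linear_combination ((rexp (-q * t) : ℂ) * φ t) * e4

/-- Frullani's formula for a scalar contraction semigroup. -/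
lemma exp_frullani_eq {φ : ℝ → ℂ} (hφ : Measurable φ) (hb : ∀ t, ‖φ t‖ ≤ 1)
    (hs : ∀ s t, 0 < s → 0 < t → φ (s + t) = φ s * φ t) {q l : ℝ} (hq : 0 < q) (hl : 0 ≤ l) :
    Complex.exp (∫ t in Ioi (0 : ℝ),
        (((rexp (-q * t) - rexp (-(q + l) * t)) / t : ℝ) : ℂ) * φ t)
      = 1 + l * ∫ t in Ioi (0 : ℝ), (rexp (-q * t) : ℂ) * φ t := by
  set R : ℝ → ℂ := fun l => ∫ t in Ioi (0 : ℝ), (rexp (-(q + l) * t) : ℂ) * φ t with hR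
  set N : ℝ → ℂ := fun l => ∫ t in Ioi (0 : ℝ),
    (((rexp (-q * t) - rexp (-(q + l) * t)) / t : ℝ) : ℂ) * φ t with hN
  have hR0 : ∫ t in Ioi (0 : ℝ), (rexp (-q * t) : ℂ) * φ t = R 0 := by simp [hR]
  have hmeas : ∀ x : ℝ, Measurable fun t : ℝ =>
      (((rexp (-q * t) - rexp (-(q + x) * t)) / t : ℝ) : ℂ) * φ t := fun x => by fun_prop
  have hderiv : ∀ x, 0 ≤ x → HasDerivAt N (R x) x := by
    intro x hx
    refine (hasDerivAt_integral_of_dominated_loc_of_deriv_le (μ := volume.restrict (Ioi (0 : ℝ)))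
      (F := fun l t => (((rexp (-q * t) - rexp (-(q + l) * t)) / t : ℝ) : ℂ) * φ t)
      (F' := fun l t => (rexp (-(q + l) * t) : ℂ) * φ t)
      (bound := fun t => rexp (-(q / 2) * t))
      (s := Metric.ball x (q / 2)) (Metric.ball_mem_nhds x (by positivity))
      (Eventually.of_forall fun y => (hmeas y).aestronglyMeasurable) ?_ ?_ ?_ ?_ ?_).2
    · refine Integrable.mono ((integrableOn_exp_neg_mul_Ioi hq).const_mul x)
        (hmeas x).aestronglyMeasurable ?_
      filter_upwards [ae_restrict_mem measurableSet_Ioi] with t ht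
      have ht : 0 < t := ht
      rw [norm_mul, Complex.norm_real, norm_of_nonneg (sub_exp_div_nonneg hx ht),
        norm_of_nonneg (mul_nonneg hx (exp_nonneg _))]
      exact (mul_le_of_le_one_right (sub_exp_div_nonneg hx ht) (hb t)).trans (sub_exp_div_le ht)
    · exact (by fun_prop : Measurable fun t => (rexp (-(q + x) * t) : ℂ) * φ t).aestronglyMeasurable
    · filter_upwards [ae_restrict_mem measurableSet_Ioi] with t ht y hy
      have ht : 0 < t := ht
      rw [norm_mul, Complex.norm_real, norm_of_nonneg (exp_nonneg _)]
      refine (mul_le_of_le_one_right (exp_nonneg _) (hb t)).trans (exp_le_exp.2 ?_)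
      rw [Metric.mem_ball, dist_eq, abs_lt] at hy
      nlinarith [hy.1]
    · exact integrableOn_exp_neg_mul_Ioi (by positivity)
    · filter_upwards [ae_restrict_mem measurableSet_Ioi] with t ht y _
      have ht : t ≠ 0 := (mem_Ioi.1 ht).ne'
      have h1 : HasDerivAt (fun y : ℝ => (rexp (-q * t) - rexp (-(q + y) * t)) / t)
          ((0 - rexp (-(q + y) * t) * (-(0 + 1) * t)) / t) y :=
        ((hasDerivAt_const y _).sub
          ((((hasDerivAt_const y q).add (hasDerivAt_id y)).neg.mul_const t).exp)).div_const t
      have h2 := (h1.ofReal_comp).mul_const (φ t)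
      have h3 : (0 - rexp (-(q + y) * t) * (-(0 + 1) * t)) / t = rexp (-(q + y) * t) := by
        field_simp
        ring
      rwa [h3] at h2
  set H : ℝ → ℂ := fun x => Complex.exp (-N x) * (1 + x * R 0) with hH
  have hHd : ∀ x, 0 ≤ x → HasDerivAt H 0 x := by
    intro x hx
    have h1 : HasDerivAt (fun x : ℝ => (1 : ℂ) + x * R 0) (0 + 1 * R 0) x :=
      (hasDerivAt_const x (1 : ℂ)).add ((hasDerivAt_id x).ofReal_comp.mul_const (R 0))
    have h2 := ((hderiv x hx).neg.cexp).mul h1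
    have h3 : (x : ℂ) * (R x * R 0) = R 0 - R x := by
      rw [← hR0]; exact laplace_resolvent hφ hb hs hq hx
    refine h2.congr_deriv ?_
    simp only [Pi.neg_apply]
    linear_combination (-Complex.exp (-N x)) * h3
  have hconst := constant_of_has_deriv_right_zero (f := H) (a := 0) (b := l)
    (fun x hx => (hHd x hx.1).continuousAt.continuousWithinAt)
    (fun x hx => (hHd x hx.1).hasDerivWithinAt) l ⟨hl, le_rfl⟩
  have hN0 : N 0 = 0 := by simp [hN]
  simp only [hH, hN0, neg_zero, Complex.exp_zero, Complex.ofReal_zero, zero_mul, add_zero,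
    mul_one] at hconst
  rw [hR0]
  calc Complex.exp (N l) = Complex.exp (N l) * (Complex.exp (-N l) * (1 + l * R 0)) := by
        rw [hconst, mul_one]
    _ = 1 + l * R 0 := by rw [← mul_assoc, ← Complex.exp_add]; simp

open scoped Measure

/-- Convolution powers of a measure. -/
def convPow (ν : Measure ℝ) : ℕ → Measure ℝ
  | 0 => Measure.dirac 0
  | n + 1 => ν ∗ convPow ν n

instance isFiniteMeasure_convPow (ν : Measure ℝ) [IsFiniteMeasure ν] (n : ℕ) :
    IsFiniteMeasure (convPow ν n) := by
  induction n with
  | zero => rw [convPow]; infer_instance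
  | succ n ih => rw [convPow]; infer_instance

lemma charFun_convPow (ν : Measure ℝ) [IsFiniteMeasure ν] (n : ℕ) (t : ℝ) :
    charFun (convPow ν n) t = charFun ν t ^ n := by
  induction n with
  | zero => simp [convPow]
  | succ n ih => rw [convPow, charFun_conv, ih, pow_succ']

lemma convPow_univ (ν : Measure ℝ) [IsFiniteMeasure ν] (n : ℕ) :
    convPow ν n univ = ν univ ^ n := by
  induction n with
  | zero => simp [convPow]
  | succ n ih =>
    rw [convPow, Measure.conv, Measure.map_apply (by fun_prop) MeasurableSet.univ, preimage_univ,
      ← univ_prod_univ, Measure.prod_prod, ih, pow_succ']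

lemma conv_apply_eq_zero {μ ν : Measure ℝ} [SFinite μ] [SFinite ν] {A B C : Set ℝ}
    (hA : μ A = 0) (hB : ν B = 0) (hC : MeasurableSet C)
    (h : ∀ x y, x ∉ A → y ∉ B → x + y ∉ C) : (μ ∗ ν) C = 0 := by
  rw [Measure.conv, Measure.map_apply (by fun_prop) hC]
  have h1 : ∀ᵐ z ∂(μ.prod ν), z.1 ∉ A :=
    Measure.quasiMeasurePreserving_fst.ae (measure_eq_zero_iff_ae_notMem.1 hA)
  have h2 : ∀ᵐ z ∂(μ.prod ν), z.2 ∉ B :=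
    Measure.quasiMeasurePreserving_snd.ae (measure_eq_zero_iff_ae_notMem.1 hB)
  rw [measure_eq_zero_iff_ae_notMem]
  filter_upwards [h1, h2] with z hz1 hz2 using h _ _ hz1 hz2

lemma convPow_Ioi_zero {ν : Measure ℝ} [IsFiniteMeasure ν] (hν : ν (Ioi 0) = 0) (n : ℕ) :
    convPow ν n (Ioi 0) = 0 := by
  induction n with
  | zero => simp [convPow]
  | succ n ih =>
    refine conv_apply_eq_zero hν ih measurableSet_Ioi fun x y hx hy => ?_
    simp only [mem_Ioi, not_lt] at *
    linarith

lemma convPow_succ_Iic_zero {ν : Measure ℝ} [IsFiniteMeasure ν] (hν : ν (Iic 0) = 0) (n : ℕ) :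
    convPow ν (n + 1) (Iic 0) = 0 := by
  have h : ∀ n, convPow ν n (Iio 0) = 0 := by
    intro n
    induction n with
    | zero => simp [convPow]
    | succ n ih =>
      refine conv_apply_eq_zero hν ih measurableSet_Iio fun x y hx hy => ?_
      simp only [mem_Iio, mem_Iic, not_le, not_lt] at *
      linarith
  refine conv_apply_eq_zero hν (h n) measurableSet_Iic fun x y hx hy => ?_
  simp only [mem_Iio, mem_Iic, not_le, not_lt] at *
  linarith

/-- The power series `∑ n, c n • ν ^ n` in the convolution algebra of measures. -/
def convSeries (c : ℕ → ℝ≥0) (ν : Measure ℝ) : Measure ℝ :=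
  Measure.sum fun n => c n • convPow ν n

lemma isFiniteMeasure_convSeries {c : ℕ → ℝ≥0} (hc : ∀ n, c n ≤ (n.factorial : ℝ≥0)⁻¹)
    (ν : Measure ℝ) [IsFiniteMeasure ν] : IsFiniteMeasure (convSeries c ν) := by
  have h1 : ∀ n, (c n • convPow ν n) univ
      ≤ ENNReal.ofReal ((ν.real univ) ^ n / n.factorial) := by
    intro n
    rw [Measure.smul_apply, convPow_univ, ENNReal.smul_def, smul_eq_mul,
      ENNReal.ofReal_div_of_pos (by positivity), ENNReal.ofReal_pow (by positivity),
      ofReal_measureReal, ENNReal.ofReal_natCast, mul_comm, div_eq_mul_inv]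
    gcongr
    have := ENNReal.coe_le_coe.2 (hc n)
    rwa [ENNReal.coe_inv (by positivity), ENNReal.coe_natCast] at this
  refine ⟨?_⟩
  rw [convSeries, Measure.sum_apply _ MeasurableSet.univ]
  refine (ENNReal.tsum_le_tsum h1).trans_lt ?_
  rw [← ENNReal.ofReal_tsum_of_nonneg (fun n => by positivity)
    (NormedSpace.expSeries_div_summable (ν.real univ))]
  exact ENNReal.ofReal_lt_top

lemma hasSum_integral_convSeries {E : Type*} [NormedAddCommGroup E] [NormedSpace ℝ E]
    {c : ℕ → ℝ≥0} {ν : Measure ℝ} {f : ℝ → E} (hf : Integrable f (convSeries c ν)) :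
    HasSum (fun n => c n • ∫ x, f x ∂(convPow ν n)) (∫ x, f x ∂(convSeries c ν)) := by
  simpa only [integral_smul_nnreal_measure, convSeries] using hasSum_integral_measure hf

lemma hasSum_charFun_convSeries {c : ℕ → ℝ≥0} (hc : ∀ n, c n ≤ (n.factorial : ℝ≥0)⁻¹)
    (ν : Measure ℝ) [IsFiniteMeasure ν] (t : ℝ) :
    HasSum (fun n => ((c n : ℝ) : ℂ) * charFun ν t ^ n) (charFun (convSeries c ν) t) := by
  have := isFiniteMeasure_convSeries hc ν
  have h := hasSum_integral_convSeries (c := c) (ν := ν)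
    (f := fun x => Complex.exp (t * x * Complex.I)) (Integrable.of_bound (C := 1)
      (by fun_prop) (Eventually.of_forall fun x => by
        rw [← Complex.ofReal_mul, Complex.norm_exp_ofReal_mul_I]))
  simp_rw [← charFun_apply_real, charFun_convPow, NNReal.smul_def, Complex.real_smul] at h
  exact h

lemma integral_convSeries_of_Ioi {c : ℕ → ℝ≥0} {ν : Measure ℝ} [IsFiniteMeasure ν]
    (hν : ν (Iic 0) = 0) {f : ℝ → ℝ} (hf : Integrable f (convSeries c ν))
    (hf0 : ∀ x, 0 < x → f x = 0) : ∫ x, f x ∂(convSeries c ν) = c 0 * f 0 := by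
  rw [← (hasSum_integral_convSeries hf).tsum_eq, tsum_eq_single 0]
  · simp [convPow, NNReal.smul_def]
  · intro n hn
    obtain ⟨m, rfl⟩ := Nat.exists_eq_succ_of_ne_zero hn
    rw [integral_eq_zero_of_ae, smul_zero]
    filter_upwards [measure_eq_zero_iff_ae_notMem.1 (convPow_succ_Iic_zero hν m)] with x hx
    exact hf0 x (by simpa using hx)

lemma integral_convSeries_of_Iic {c : ℕ → ℝ≥0} {ν : Measure ℝ} [IsFiniteMeasure ν]
    (hν : ν (Ioi 0) = 0) {f : ℝ → ℝ} (hf0 : ∀ x ≤ 0, f x = 0) :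
    ∫ x, f x ∂(convSeries c ν) = 0 := by
  have h : convSeries c ν (Ioi 0) = 0 := by
    rw [convSeries, Measure.sum_apply _ measurableSet_Ioi]
    simp [convPow_Ioi_zero hν]
  refine integral_eq_zero_of_ae ?_
  filter_upwards [measure_eq_zero_iff_ae_notMem.1 h] with x hx
  exact hf0 x (by simpa using hx)

/-- The measures `cosh ν` and `sinh ν` satisfy `cosh ν - sinh ν = exp (-ν)`. -/
lemma charFun_convSeries_even_sub_odd (ν : Measure ℝ) [IsFiniteMeasure ν] (t : ℝ) :
    charFun (convSeries (fun n => if Even n then (n.factorial : ℝ≥0)⁻¹ else 0) ν) t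
      - charFun (convSeries (fun n => if Even n then 0 else (n.factorial : ℝ≥0)⁻¹) ν) t
      = Complex.exp (-charFun ν t) := by
  have h1 := (hasSum_charFun_convSeries (c := fun n => if Even n then (n.factorial : ℝ≥0)⁻¹ else 0)
    (fun n => by split_ifs <;> simp) ν t).sub
    (hasSum_charFun_convSeries (c := fun n => if Even n then 0 else (n.factorial : ℝ≥0)⁻¹)
    (fun n => by split_ifs <;> simp) ν t)
  have h2 : HasSum (fun n : ℕ => (-charFun ν t) ^ n / (n.factorial : ℂ))
      (Complex.exp (-charFun ν t)) := by
    rw [Complex.exp_eq_exp_ℂ]; exact NormedSpace.expSeries_div_hasSum_exp _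
  refine h1.unique ((congrArg (HasSum · _) (funext fun n => ?_)).mpr h2)
  rcases Nat.even_or_odd n with h | h
  · simp [h, h.neg_pow, div_eq_inv_mul]
  · simp [Nat.not_even_iff_odd.2 h, h.neg_pow, div_eq_inv_mul]

lemma charFun_convSeries_exp (ν : Measure ℝ) [IsFiniteMeasure ν] (t : ℝ) :
    charFun (convSeries (fun n => (n.factorial : ℝ≥0)⁻¹) ν) t = Complex.exp (charFun ν t) := by
  have h2 : HasSum (fun n : ℕ => (charFun ν t) ^ n / (n.factorial : ℂ))
      (Complex.exp (charFun ν t)) := by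
    rw [Complex.exp_eq_exp_ℂ]; exact NormedSpace.expSeries_div_hasSum_exp _
  refine (hasSum_charFun_convSeries (fun n => le_rfl) ν t).unique ?_
  convert h2 using 1
  funext n
  simp [div_eq_inv_mul]

lemma charFun_add_measure (μ ν : Measure ℝ) [IsFiniteMeasure μ] [IsFiniteMeasure ν] (t : ℝ) :
    charFun (μ + ν) t = charFun μ t + charFun ν t := by
  simp_rw [charFun_apply_real]
  refine integral_add_measure ?_ ?_ <;>
  exact Integrable.of_bound (C := 1) (by fun_prop) (Eventually.of_forall fun x => by
        rw [← Complex.ofReal_mul, Complex.norm_exp_ofReal_mul_I])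

/-- Uniqueness for a Wiener–Hopf equation on the half-line whose kernel `δ₀ + κ` is a convolution
exponential. -/
lemma wienerHopf_apply_zero {ν κ : Measure ℝ} [IsFiniteMeasure ν] [IsFiniteMeasure κ]
    (hνκ : ∀ t, Complex.exp (charFun ν t) = 1 + charFun κ t) {v : ℝ → ℝ} (hv : Measurable v)
    {C K : ℝ} (hC : ∀ x, ‖v x‖ ≤ C)
    (hK : ∀ y, v y + ∫ z, (Ioi 0).indicator v (y + z) ∂κ = K) :
    v 0 = K * rexp (-ν.real (Ioi 0)) := by
  set νp := ν.restrict (Ioi 0) with hνp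
  set νm := ν.restrict (Iic 0) with hνm
  have hsplit : νp + νm = ν := by
    rw [hνp, hνm, ← compl_Ioi]; exact Measure.restrict_add_restrict_compl measurableSet_Ioi
  have hp0 : νp (Iic 0) = 0 := by
    rw [hνp, Measure.restrict_apply measurableSet_Iic, Iic_inter_Ioi]; simp
  have hm0 : νm (Ioi 0) = 0 := by
    rw [hνm, Measure.restrict_apply measurableSet_Ioi, Ioi_inter_Iic]; simp
  set ce : ℕ → ℝ≥0 := fun n => if Even n then (n.factorial : ℝ≥0)⁻¹ else 0 with hce
  set co : ℕ → ℝ≥0 := fun n => if Even n then 0 else (n.factorial : ℝ≥0)⁻¹ with hco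
  set E := convSeries ce νp with hE
  set O := convSeries co νp with hO
  set M := convSeries (fun n => (n.factorial : ℝ≥0)⁻¹) νm with hM
  have : IsFiniteMeasure E := isFiniteMeasure_convSeries (fun n => by
    simp only [hce]; split_ifs <;> simp) _
  have : IsFiniteMeasure O := isFiniteMeasure_convSeries (fun n => by
    simp only [hco]; split_ifs <;> simp) _
  have : IsFiniteMeasure M := isFiniteMeasure_convSeries (fun n => le_rfl) _
  have hEO : ∀ t, charFun E t - charFun O t = Complex.exp (-charFun νp t) :=
    charFun_convSeries_even_sub_odd νp
  have hid : E + E ∗ κ = O + O ∗ κ + M := by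
    refine Measure.ext_of_charFun (funext fun t => ?_)
    simp only [charFun_add_measure, charFun_conv]
    rw [hM, charFun_convSeries_exp]
    have h1 := hEO t
    have h2 := hνκ t
    rw [← hsplit, charFun_add_measure, Complex.exp_add] at h2
    have h3 : Complex.exp (-charFun νp t) * Complex.exp (charFun νp t) = 1 := by
      rw [← Complex.exp_add]; simp
    linear_combination (1 + charFun κ t) * h1 - Complex.exp (-charFun νp t) * h2
      + Complex.exp (charFun νm t) * h3
  set vp := (Ioi (0 : ℝ)).indicator v with hvp
  set vm := (Iic (0 : ℝ)).indicator v with hvm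
  have hvpm : Measurable vp := hv.indicator measurableSet_Ioi
  have hvmm : Measurable vm := hv.indicator measurableSet_Iic
  have hpi : ∀ μ : Measure ℝ, IsFiniteMeasure μ → Integrable vp μ := fun μ _ =>
    Integrable.of_bound hvpm.aestronglyMeasurable C
      (Eventually.of_forall fun x => (norm_indicator_le_norm_self _ _).trans (hC x))
  have hmi : ∀ μ : Measure ℝ, IsFiniteMeasure μ → Integrable vm μ := fun μ _ =>
    Integrable.of_bound hvmm.aestronglyMeasurable C
      (Eventually.of_forall fun x => (norm_indicator_le_norm_self _ _).trans (hC x))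
  have hsum : ∀ x, v x = vm x + vp x := fun x => by
    by_cases hx : 0 < x
    · simp [hvp, hvm, hx]
    · simp [hvp, hvm, hx, not_lt.1 hx]
  have hint : ∀ μ : Measure ℝ, IsFiniteMeasure μ →
      ∫ x, vm x ∂μ + ∫ x, vp x ∂(μ + μ ∗ κ) = K * μ.real univ := by
    intro μ _
    rw [integral_add_measure (hpi _ inferInstance) (hpi _ inferInstance),
      integral_conv (hpi _ inferInstance), ← add_assoc,
      ← integral_add (hmi _ inferInstance) (hpi _ inferInstance)]
    have h1 : ∀ x, ∫ y, vp (x + y) ∂κ = K - (vm x + vp x) := fun x => by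
      rw [← hsum, ← hK x]; ring
    simp_rw [h1]
    rw [integral_sub (integrable_const _)
      (show Integrable (fun x => vm x + vp x) μ from
        (hmi _ inferInstance).add (hpi _ inferInstance))]
    simp [mul_comm]
  have heven := hint E inferInstance
  have hodd := hint O inferInstance
  rw [hid, integral_add_measure (hpi _ inferInstance) (hpi _ inferInstance),
    integral_convSeries_of_Iic hm0 (f := vp) (fun x hx => by simp [hvp, hx]), add_zero,
    integral_convSeries_of_Ioi hp0 (hmi _ inferInstance) (fun x hx => by simp [hvm, hx])] at heven
  rw [integral_convSeries_of_Ioi hp0 (hmi _ inferInstance) (fun x hx => by simp [hvm, hx])] at hodd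
  have hmass := hEO 0
  simp only [charFun_zero] at hmass
  have hmass : E.real univ - O.real univ = rexp (-νp.real univ) := by exact_mod_cast hmass
  have hνp' : νp.real univ = ν.real (Ioi 0) := by simp [hνp]
  have hvm0 : vm 0 = v 0 := by simp [hvm]
  simp only [hce, hco, hvm0] at heven hodd
  rw [← hνp', ← hmass]
  simp at heven hodd
  linarith

/-- The occupation measure of `Y` on `(0, ∞)` in time weighted by `w`. -/
def weightedOccupation (P : Measure Ω) (Y : ℝ → Ω → ℝ) (w : ℝ → ℝ) : Measure ℝ :=
  (((volume.restrict (Ioi (0 : ℝ))).withDensity fun t => ENNReal.ofReal (w t)).prod P).map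
    (Function.uncurry Y)

lemma isFiniteMeasure_weightedOccupation {P : Measure Ω} [IsProbabilityMeasure P]
    {Y : ℝ → Ω → ℝ} {w : ℝ → ℝ} (hw : IntegrableOn w (Ioi 0)) :
    IsFiniteMeasure (weightedOccupation P Y w) := by
  have := isFiniteMeasure_withDensity_ofReal hw.2
  unfold weightedOccupation
  infer_instance

lemma integral_weightedOccupation {P : Measure Ω} [IsProbabilityMeasure P]
    {Y : ℝ → Ω → ℝ} (hY : Measurable (Function.uncurry Y)) {w : ℝ → ℝ} (hwm : Measurable w)
    (hw : IntegrableOn w (Ioi 0)) (hw0 : ∀ t, 0 < t → 0 ≤ w t)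
    {E : Type*} [NormedAddCommGroup E] [NormedSpace ℝ E] [MeasurableSpace E] [BorelSpace E]
    [SecondCountableTopology E] {f : ℝ → E}
    (hf : Measurable f) {C : ℝ} (hC : ∀ x, ‖f x‖ ≤ C) :
    ∫ x, f x ∂(weightedOccupation P Y w) = ∫ t in Ioi (0 : ℝ), w t • ∫ ω, f (Y t ω) ∂P := by
  have := isFiniteMeasure_withDensity_ofReal hw.2
  rw [weightedOccupation, integral_map hY.aemeasurable hf.aestronglyMeasurable, integral_prod,
    integral_withDensity_eq_integral_toReal_smul (by fun_prop)
      (Eventually.of_forall fun t => ENNReal.ofReal_lt_top)]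
  · refine setIntegral_congr_fun measurableSet_Ioi fun t ht => ?_
    simp only [Function.uncurry, ENNReal.toReal_ofReal (hw0 t ht)]
  · exact Integrable.of_bound (hf.comp hY).aestronglyMeasurable C
      (Eventually.of_forall fun z => hC _)

lemma IsLevyProcess.charFun_map_add {P : Measure Ω} [IsProbabilityMeasure P] {X : ℝ → Ω → ℝ}
    (hX : IsLevyProcess P X) {s t : ℝ} (hs : 0 ≤ s) (ht : 0 ≤ t) (u : ℝ) :
    charFun (P.map (X (s + t))) u = charFun (P.map (X s)) u * charFun (P.map (X t)) u := by
  have h1 : IndepFun (X s) (fun ω => X (s + t) ω - X s ω) P :=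
    ((hX.indep s (s + t) hs (by linarith) 1 (fun _ => s) (fun _ => ⟨hs, le_rfl⟩)).comp
      measurable_id (measurable_pi_apply (0 : Fin 1))).symm
  have h2 : X (s + t) = X s + fun ω => X (s + t) ω - X s ω := by ext ω; simp
  have h3 := hX.stationary s (s + t) hs (by linarith)
  rw [add_sub_cancel_left] at h3
  rw [← h3]
  conv_lhs => rw [h2]
  exact congrFun (h1.charFun_map_add_eq_mul (hX.measurable s).aemeasurable
    ((hX.measurable _).sub (hX.measurable s)).aemeasurable) u

lemma IsLevyProcess.map_rightVersion {P : Measure Ω} {X : ℝ → Ω → ℝ} (hX : IsLevyProcess P X)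
    {t : ℝ} (ht : 0 ≤ t) : P.map (rightVersion X t) = P.map (X t) :=
  Measure.map_congr (hX.ae_rightVersion_eq.mono fun _ h => h t ht)

lemma integrableOn_sub_exp_div {q l : ℝ} (hq : 0 < q) (hl : 0 ≤ l) :
    IntegrableOn (fun t => (rexp (-q * t) - rexp (-(q + l) * t)) / t) (Ioi 0) := by
  refine Integrable.mono ((integrableOn_exp_neg_mul_Ioi hq).const_mul l)
    (by fun_prop : Measurable fun t : ℝ => (rexp (-q * t) - rexp (-(q + l) * t)) / t
      ).aestronglyMeasurable ?_
  filter_upwards [ae_restrict_mem measurableSet_Ioi] with t ht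
  rw [norm_of_nonneg (sub_exp_div_nonneg hl ht), norm_of_nonneg (mul_nonneg hl (exp_nonneg _))]
  exact sub_exp_div_le ht

lemma charFun_weightedOccupation {P : Measure Ω} [IsProbabilityMeasure P]
    {Y : ℝ → Ω → ℝ} (hY : Measurable (Function.uncurry Y)) {w : ℝ → ℝ} (hwm : Measurable w)
    (hw : IntegrableOn w (Ioi 0)) (hw0 : ∀ t, 0 < t → 0 ≤ w t) (u : ℝ) :
    charFun (weightedOccupation P Y w) u
      = ∫ t in Ioi (0 : ℝ), (w t : ℂ) * charFun (P.map (Y t)) u := by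
  rw [charFun_apply_real, integral_weightedOccupation hY hwm hw hw0 (by fun_prop) (C := 1)
    fun x => by rw [← Complex.ofReal_mul, Complex.norm_exp_ofReal_mul_I]]
  refine integral_congr_ae (Eventually.of_forall fun t => ?_)
  have hYt : Measurable (Y t) := hY.comp measurable_prodMk_left
  simp only [Complex.real_smul, charFun_apply_real]
  rw [integral_map hYt.aemeasurable (by fun_prop)]

lemma measurable_charFun_map {P : Measure Ω} [IsProbabilityMeasure P]
    {Y : ℝ → Ω → ℝ} (hY : Measurable (Function.uncurry Y)) (u : ℝ) :
    Measurable fun t => charFun (P.map (Y t)) u := by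
  have h : ∀ t, charFun (P.map (Y t)) u = ∫ ω, Complex.exp (u * Y t ω * Complex.I) ∂P := fun t => by
    have hYt : Measurable (Y t) := hY.comp measurable_prodMk_left
    rw [charFun_apply_real, integral_map hYt.aemeasurable (by fun_prop)]
  simp_rw [h]
  have hm : Measurable (fun z : ℝ × Ω => Complex.exp (u * Y z.1 z.2 * Complex.I)) :=
    (by fun_prop : Measurable fun y : ℝ => Complex.exp (u * y * Complex.I)).comp hY
  exact (hm.stronglyMeasurable.integral_prod_right' (ν := P)).measurable

lemma IsLevyProcess.exp_charFun_weightedOccupation {P : Measure Ω} [IsProbabilityMeasure P]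
    {X : ℝ → Ω → ℝ} (hX : IsLevyProcess P X) {q l : ℝ} (hq : 0 < q) (hl : 0 ≤ l) (u : ℝ) :
    Complex.exp (charFun (weightedOccupation P (rightVersion X)
        fun t => (rexp (-q * t) - rexp (-(q + l) * t)) / t) u)
      = 1 + charFun (weightedOccupation P (rightVersion X) fun t => l * rexp (-q * t)) u := by
  have hY := measurable_uncurry_rightVersion hX.measurable
  rw [charFun_weightedOccupation hY (by fun_prop) (integrableOn_sub_exp_div hq hl)
      (fun t ht => sub_exp_div_nonneg hl ht),
    charFun_weightedOccupation hY (by fun_prop) ((integrableOn_exp_neg_mul_Ioi hq).const_mul l)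
      (fun t _ => by positivity),
    exp_frullani_eq (measurable_charFun_map hY u) (fun t => ?_) (fun s t hs ht => ?_) hq hl,
    ← integral_const_mul]
  · simp_rw [Complex.ofReal_mul, mul_assoc]
  · have hYt : Measurable (rightVersion X t) := hY.comp measurable_prodMk_left
    have := Measure.isProbabilityMeasure_map (μ := P) hYt.aemeasurable
    exact norm_charFun_le_one u
  · rw [hX.map_rightVersion hs.le, hX.map_rightVersion ht.le,
      hX.map_rightVersion (add_pos hs ht).le, hX.charFun_map_add hs.le ht.le]

lemma IsLevyProcess.sojournTransform_zero {P : Measure Ω} [IsProbabilityMeasure P]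
    {X : ℝ → Ω → ℝ} (hX : IsLevyProcess P X) {q l : ℝ} (hq : 0 < q) (hl : 0 ≤ l) :
    sojournTransform P (rightVersion X) q l 0
      = q⁻¹ * rexp (-∫ t in Ioi (0 : ℝ), (rexp (-q * t) - rexp (-(q + l) * t)) / t
        * P.real {ω | 0 < rightVersion X t ω}) := by
  have hY := measurable_uncurry_rightVersion hX.measurable
  have hwR : IntegrableOn (fun t => l * rexp (-q * t)) (Ioi 0) :=
    (integrableOn_exp_neg_mul_Ioi hq).const_mul l
  have hwν := integrableOn_sub_exp_div hq hl
  have := isFiniteMeasure_weightedOccupation (P := P) (Y := rightVersion X) hwR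
  have := isFiniteMeasure_weightedOccupation (P := P) (Y := rightVersion X) hwν
  have hv := measurable_sojournTransform (P := P) hY (q := q) (l := l)
  have hC := norm_sojournTransform_le (P := P) (Y := rightVersion X) hq hl
  rw [wienerHopf_apply_zero (hX.exp_charFun_weightedOccupation hq hl) hv hC (K := q⁻¹)
    fun y => ?_]
  · congr 3
    rw [← integral_indicator_one measurableSet_Ioi, integral_weightedOccupation hY (by fun_prop) hwν
      (fun t ht => sub_exp_div_nonneg hl ht) (measurable_one.indicator measurableSet_Ioi) (C := 1)
      (fun x => (norm_indicator_le_norm_self _ _).trans (by simp))]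
    refine integral_congr_ae (Eventually.of_forall fun t => ?_)
    have hYt : Measurable (rightVersion X t) := hY.comp measurable_prodMk_left
    simp only [smul_eq_mul]
    rw [← integral_indicator_one (measurableSet_lt measurable_const hYt)]
    rfl
  · have hm : Measurable fun z =>
        (Ioi 0).indicator (sojournTransform P (rightVersion X) q l) (y + z) :=
      (hv.indicator measurableSet_Ioi).comp (measurable_const_add y)
    rw [integral_weightedOccupation hY (by fun_prop) hwR (fun t _ => by positivity) hm
      (fun x => (norm_indicator_le_norm_self _ _).trans (hC _)),
      sojournTransform_eq_sub hY hq hl y fun s r hs hr => hX.integral_shift_sojourn hl hs hr y,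
      ← integral_const_mul, sub_add_eq_add_sub, add_sub_assoc, add_eq_left, sub_eq_zero]
    refine integral_congr_ae (Eventually.of_forall fun t => ?_)
    simp only [smul_eq_mul, indicator, mem_Ioi, ite_mul, one_mul, zero_mul, mul_assoc]

/-- **Double Laplace transform of the positive sojourn time of a Lévy process.**
For all `q, λ > 0`,
`∫_0^∞ e^{-qt} E[e^{-λ A_t}] dt = q⁻¹ exp(-∫_0^∞ e^{-qt} t⁻¹ P(X_t > 0)(1 - e^{-λt}) dt)`. -/
theorem levy_sojourn_double_laplace (P : Measure Ω) [IsProbabilityMeasure P]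
    (X : ℝ → Ω → ℝ) (hX : IsLevyProcess P X) (q lam : ℝ) (hq : 0 < q) (hlam : 0 < lam) :
    ∫ t in Set.Ioi (0:ℝ), Real.exp (-q * t) * ∫ ω, Real.exp (-lam * sojourn X t ω) ∂P
      = q⁻¹ * Real.exp (- ∫ t in Set.Ioi (0:ℝ),
          Real.exp (-q * t) * t⁻¹ * (P {ω | 0 < X t ω}).toReal * (1 - Real.exp (-lam * t))) := by
  have h0 : ∀ t ∈ Ioi (0 : ℝ), rexp (-q * t) * ∫ ω, rexp (-lam * sojourn X t ω) ∂P
      = rexp (-q * t)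
        * ∫ ω, rexp (-lam * sojourn (fun u ω => 0 + rightVersion X u ω) t ω) ∂P := by
    intro t ht
    congr 1
    refine integral_congr_ae ?_
    filter_upwards [hX.ae_rightVersion_eq] with ω hω
    rw [sojourn_congr (Z' := fun u ω => 0 + rightVersion X u ω) (mem_Ioi.1 ht).le
      fun s hs => ((zero_add _).trans (hω s hs)).symm]
  rw [setIntegral_congr_fun measurableSet_Ioi h0]
  refine (hX.sojournTransform_zero hq hlam.le).trans ?_
  congr 3
  refine setIntegral_congr_fun measurableSet_Ioi fun t ht => ?_
  have h1 : P {ω | 0 < rightVersion X t ω} = P {ω | 0 < X t ω} := by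
    refine measure_congr ?_
    filter_upwards [hX.ae_rightVersion_eq] with ω hω
    exact congrArg (0 < ·) (hω t (mem_Ioi.1 ht).le)
  have h2 : rexp (-(q + lam) * t) = rexp (-q * t) * rexp (-lam * t) := by
    rw [← Real.exp_add]; ring_nf
  simp only [Measure.real, h1, h2]
  ring

end
end
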